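/- If f is a nonnegative trigonometric polynomial on [−π,π]², f(x,y) = ∑_{j,k=−n}^{n} a_{jk} e^{i(jx+ky)} ≥ 0 for some finite n ≥ 1 and real numbers a_{jk}, then for all m ≥ 1 the (2m)-th moment of μ_f equals ∑_{σ ∈ NC₂(2m)} ∑_{k ∈ S(σ)} ∏_{(u,v) ∈ σ} ∫_{[−π,π]²} e^{i(k_u x + k_v y)} [f(x,−y) + f(−y,x)] dx dy, which also equals (2π)^{m−1} ∑_{σ ∈ NC₂(2m)} ∫_{[−π,π]^{m+1}} L_{σ,f}(x) dx. -/

import Mathlib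

open MeasureTheory ProbabilityTheory Filter Real

noncomputable section

/-- The square `(-π, π]²` on which the spectral measure lives. -/
def specBox : Set (ℝ × ℝ) := Set.Ioc (-π) π ×ˢ Set.Ioc (-π) π

/-- `(1/N) ∑_j g(λ_j(A))`, the integral of `g` against the empirical spectral
distribution of a symmetric `N × N` real matrix `A` (junk value `0` if `A` is
not symmetric). -/
def esdEval {N : ℕ} (A : Matrix (Fin N) (Fin N) ℝ) (g : ℝ → ℝ) : ℝ :=
  if hA : A.IsHermitian then (N : ℝ)⁻¹ * ∑ j, g (hA.eigenvalues j) else 0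

/-- The (random) empirical spectral distributions of `A N` converge weakly in
probability to the probability measure `μ`: for every bounded continuous `g`,
`∫ g d(ESD(A N)) → ∫ g dμ` in probability. -/
def ESDTendstoInProb {Ω : Type*} [MeasurableSpace Ω] (P : Measure Ω)
    (A : (N : ℕ) → Ω → Matrix (Fin N) (Fin N) ℝ) (μ : Measure ℝ) : Prop :=
  ∀ g : ℝ → ℝ, Continuous g → (∃ C, ∀ x, |g x| ≤ C) →
    ∀ ε > 0, Tendsto (fun N => P {ω | ε ≤ |esdEval (A N ω) g - ∫ x, g x ∂μ|})
      atTop (nhds 0)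

/-- The symmetric matrix `W_N/√N`, where `W_N(i,j) = X_{i,j} + X_{j,i}`,
`1 ≤ i,j ≤ N`. -/
def scaledW {Ω : Type*} (X : ℤ → ℤ → Ω → ℝ) (N : ℕ) (ω : Ω) :
    Matrix (Fin N) (Fin N) ℝ :=
  fun i j => (Real.sqrt N)⁻¹ *
    (X ((i : ℕ) + 1) ((j : ℕ) + 1) ω + X ((j : ℕ) + 1) ((i : ℕ) + 1) ω)

/-- A centered stationary Gaussian process indexed by `ℤ²` with positive
variance: every finite real linear combination is a centered Gaussian random
variable, and second moments are shift invariant. -/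
structure StatGauss {Ω : Type*} [MeasurableSpace Ω] (P : Measure Ω)
    (X : ℤ → ℤ → Ω → ℝ) : Prop where
  meas : ∀ j k, Measurable (X j k)
  gauss : ∀ c : (ℤ × ℤ) →₀ ℝ, ∃ v : NNReal,
    P.map (fun ω => ∑ p ∈ c.support, c p * X p.1 p.2 ω) = gaussianReal 0 v
  var_pos : 0 < ∫ ω, (X 0 0 ω) ^ 2 ∂P
  stat : ∀ j k u v : ℤ,
    ∫ ω, X j k ω * X (j + u) (k + v) ω ∂P = ∫ ω, X 0 0 ω * X u v ω ∂P

/-- The process `X` has absolutely continuous spectral measure with density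
`h` on `(-π,π]²`: `E[X_{0,0} X_{u,v}] = ∫∫ e^{i(ux+vy)} h(x,y) dx dy`. -/
def HasSpecDensity {Ω : Type*} [MeasurableSpace Ω] (P : Measure Ω)
    (X : ℤ → ℤ → Ω → ℝ) (h : ℝ × ℝ → ℝ) : Prop :=
  ∀ u v : ℤ,
    (∫ q in specBox,
        Complex.exp (Complex.I * ((u * q.1 + v * q.2 : ℝ) : ℂ)) * ((h q : ℝ) : ℂ))
      = ((∫ ω, X 0 0 ω * X u v ω ∂P : ℝ) : ℂ)

/-- Non-crossing pair partitions of `{1, …, 2m}`, encoded as fixed-point free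
involutions of `Fin (2m)` with no crossing `a < b < p a < p b`. -/
def NCPairings (m : ℕ) : Finset (Equiv.Perm (Fin (2 * m))) :=
  Finset.univ.filter fun p =>
    (∀ i, p (p i) = i) ∧ (∀ i, p i ≠ i) ∧
      ∀ a b : Fin (2 * m), ¬(a < b ∧ b < p a ∧ p a < p b)

/-- The permutation `i ↦ p (i + 1)` whose cycles are exactly the blocks of the
Kreweras complement of the pair partition `p`. -/
def krewPerm (m : ℕ) (p : Equiv.Perm (Fin (2 * m))) : Equiv.Perm (Fin (2 * m)) :=
  (finRotate (2 * m)).trans p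

/-- `T : {1,…,2m} → {1,…,m+1}` indexes the blocks `V_1, …, V_{m+1}` of the
Kreweras complement of `p` (`T i` is the index of the block containing `i`),
with the blocks ordered so that their maximal elements increase. -/
def IsKrewerasIndex (m : ℕ) (p : Equiv.Perm (Fin (2 * m)))
    (T : Fin (2 * m) → Fin (m + 1)) : Prop :=
  Function.Surjective T ∧
  (∀ i j, T i = T j ↔ (krewPerm m p).SameCycle i j) ∧
  ∀ a b : Fin (m + 1), a < b →
    (Finset.univ.filter fun i => T i = a).max <
      (Finset.univ.filter fun i => T i = b).max

open Classical in
/-- `k ∈ S(σ)`: the sum of the `k_j` over every block of the Kreweras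
complement of `p` vanishes. -/
def memS (m : ℕ) (p : Equiv.Perm (Fin (2 * m))) (k : Fin (2 * m) → ℤ) : Prop :=
  ∀ i, ∑ j ∈ Finset.univ.filter (fun j => (krewPerm m p).SameCycle i j), k j = 0

/-- The function `L_{σ,f}` on `[-π,π]^{m+1}`: the product over the pairs
`(u, v)` of `σ` (with `u < v = p u`) of
`f(x_{T u}, -x_{T v}) + f(-x_{T v}, x_{T u})`. -/
def Lsig (m : ℕ) (p : Equiv.Perm (Fin (2 * m))) (T : Fin (2 * m) → Fin (m + 1))
    (f : ℝ → ℝ → ℝ) (x : Fin (m + 1) → ℝ) : ℝ :=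
  ∏ i ∈ Finset.univ.filter (fun i => i < p i),
    (f (x (T i)) (-x (T (p i))) + f (-x (T (p i))) (x (T i)))

open scoped Nat in
lemma gm_std (m : ℕ) : ∫ x, x ^ (2 * m) ∂(gaussianReal 0 1) = ((2 * m - 1 : ℕ)‼ : ℝ) := by
  rw [integral_gaussianReal_eq_integral_smul one_ne_zero]
  have h1 : (fun x : ℝ => gaussianPDFReal 0 1 x • x ^ (2 * m)) =
      fun x => (√(2 * π))⁻¹ * ((fun y : ℝ => y ^ ((2 * m : ℕ) : ℝ) * rexp (-(1/2) * y ^ (2:ℝ))) |x|) := by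
    funext x
    simp only [gaussianPDFReal, smul_eq_mul, rpow_natCast, NNReal.coe_one, mul_one, sub_zero]
    rw [show ((2:ℝ)) = ((2:ℕ):ℝ) by norm_num, rpow_natCast, sq_abs, (even_two_mul m).pow_abs]
    rw [show (-x ^ 2 / ((2:ℕ):ℝ)) = -(1 / ((2:ℕ):ℝ)) * x ^ 2 by ring]
    ring
  rw [h1, integral_const_mul, integral_comp_abs (f := fun y : ℝ => y ^ ((2 * m : ℕ) : ℝ) * rexp (-(1/2) * y ^ (2:ℝ))),
    integral_rpow_mul_exp_neg_mul_rpow (by norm_num)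
    (by have : (0:ℝ) ≤ ((2*m : ℕ):ℝ) := by positivity
        linarith) (by norm_num)]
  have h2 : (((2 * m : ℕ):ℝ) + 1) / 2 = m + 1/2 := by push_cast; ring
  have h3 : -(((2 * m : ℕ):ℝ) + 1) / 2 = -(m + 1/2) := by push_cast; ring
  rw [h2, h3, Real.Gamma_nat_add_half, one_div, Real.inv_rpow (by norm_num), Real.rpow_neg (by norm_num), inv_inv,
    Real.rpow_add (by norm_num), rpow_natCast, Real.sqrt_mul (by norm_num), ← one_div (2:ℝ), ← Real.sqrt_eq_rpow]
  field_simp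

open scoped Nat in
lemma gm (v : NNReal) (m : ℕ) :
    ∫ x, x ^ (2 * m) ∂(gaussianReal 0 v) = ((2 * m - 1 : ℕ)‼ : ℝ) * (v : ℝ) ^ m := by
  have h := gaussianReal_map_const_mul (μ := 0) (v := 1) (√v)
  have h2 : gaussianReal 0 v = (gaussianReal 0 1).map (fun x => √v * x) := by
    rw [h]; congr 1
    · simp
    · ext; simp
  rw [h2, integral_map (by fun_prop) (by fun_prop)]
  simp_rw [mul_pow]
  rw [integral_const_mul, gm_std, pow_mul, Real.sq_sqrt v.coe_nonneg, mul_comm]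

lemma gm_int (v : NNReal) (k : ℕ) : Integrable (fun x => x ^ k) (gaussianReal 0 v) := by
  have := (memLp_id_gaussianReal (μ := 0) (v := v) k).integrable_norm_pow'
  refine (integrable_norm_iff (by fun_prop)).1 ?_
  simpa [norm_pow] using this

/-- sign -/
def sg (b : Bool) : ℝ := if b then 1 else -1

lemma sg_mul_self (b : Bool) : sg b * sg b = 1 := by cases b <;> simp [sg]
lemma sg_not (b : Bool) : sg (!b) = - sg b := by cases b <;> simp [sg]

lemma polar {α β : Type} [Fintype α] [Fintype β] [DecidableEq α] [DecidableEq β]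
    (hc : Fintype.card α = Fintype.card β) (F : (α → β) → ℝ) :
    ∑ ε : β → Bool, (∏ b, sg (ε b)) * ∑ φ : α → β, F φ * ∏ a, sg (ε (φ a)) =
      2 ^ (Fintype.card β) * ∑ e : α ≃ β, F e := by
  simp_rw [Finset.mul_sum]
  rw [Finset.sum_comm]
  have h0 : ∀ φ : α → β, ¬ Function.Bijective φ →
      ∑ ε : β → Bool, (∏ b, sg (ε b)) * (F φ * ∏ a, sg (ε (φ a))) = 0 := by
    intro φ hφ
    have hs : ¬ Function.Surjective φ := fun h =>
      hφ ((Fintype.bijective_iff_surjective_and_card φ).2 ⟨h, hc⟩)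
    obtain ⟨b0, hb0⟩ := not_forall.1 hs
    have hb0' : ∀ a, φ a ≠ b0 := fun a h => hb0 ⟨a, h⟩
    refine Finset.sum_involution (fun ε _ => Function.update ε b0 (!ε b0)) ?_ ?_ (by simp) ?_
    · intro ε _
      have h1 : ∀ a, Function.update ε b0 (!ε b0) (φ a) = ε (φ a) := fun a =>
        Function.update_of_ne (hb0' a) _ _
      simp_rw [h1]
      have h2 : ∏ b, sg (Function.update ε b0 (!ε b0) b) = - ∏ b, sg (ε b) := by
        rw [← Finset.mul_prod_erase _ _ (Finset.mem_univ b0), ← Finset.mul_prod_erase Finset.univ (fun b => sg (ε b)) (Finset.mem_univ b0)]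
        rw [Function.update_self, sg_not, neg_mul]
        congr 2
        refine Finset.prod_congr rfl fun b hb => ?_
        rw [Function.update_of_ne (Finset.ne_of_mem_erase hb)]
      rw [h2]; ring
    · intro ε _ _ h
      have := congrFun h b0
      simp at this
    · intro ε _
      simp
  have h1 : ∀ e : α ≃ β, ∑ ε : β → Bool, (∏ b, sg (ε b)) * (F e * ∏ a, sg (ε (e a))) = 2 ^ (Fintype.card β) * F e := by
    intro e
    have : ∀ ε : β → Bool, (∏ b, sg (ε b)) * (F e * ∏ a, sg (ε (e a))) = F e := by
      intro ε
      rw [Equiv.prod_comp e (fun b => sg (ε b)), mul_left_comm, ← Finset.prod_mul_distrib]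
      simp [sg_mul_self]
    simp_rw [this]
    simp
  simp_rw [← h1]
  classical
  rw [← Finset.sum_filter_of_ne (p := fun φ : α → β => Function.Bijective φ)
    (fun φ _ h => by by_contra h'; exact h (h0 φ h'))]
  symm
  refine Finset.sum_bij (fun e _ => (e : α → β)) ?_ ?_ ?_ ?_
  · intro e _; simp
  · intro e _ e' _ h; exact Equiv.coe_fn_injective h
  · intro φ hφ
    exact ⟨Equiv.ofBijective φ (Finset.mem_filter.1 hφ).2, Finset.mem_univ _, rfl⟩
  · intro e _; rfl

section wick
set_option linter.unusedSectionVars false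
variable {Ω : Type} [MeasurableSpace Ω] {P : Measure Ω} [IsProbabilityMeasure P]
  {β : Type} [Fintype β] [DecidableEq β] {Z : β → Ω → ℝ}

/-- Jointly centered Gaussian family -/
def JG (P : Measure Ω) (Z : β → Ω → ℝ) : Prop :=
  (∀ b, Measurable (Z b)) ∧
  ∀ t : β → ℝ, ∃ v : NNReal, P.map (fun ω => ∑ b, t b * Z b ω) = gaussianReal 0 v

lemma JG.int_pow (h : JG P Z) (t : β → ℝ) (k : ℕ) :
    Integrable (fun ω => (∑ b, t b * Z b ω) ^ k) P := by
  obtain ⟨v, hv⟩ := h.2 t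
  have hm : Measurable (fun ω => ∑ b, t b * Z b ω) := by
    have := h.1; fun_prop
  have := gm_int v k
  rw [← hv] at this
  exact this.comp_measurable hm

lemma JG.memLp (h : JG P Z) (b : β) : MemLp (Z b) 2 P := by
  have h1 := h.int_pow (fun c => if c = b then 1 else 0) 2
  simp only [ite_mul, one_mul, zero_mul, Finset.sum_ite_eq', Finset.mem_univ, if_true] at h1
  exact (memLp_two_iff_integrable_sq (h.1 b).aestronglyMeasurable).2 h1

lemma JG.int_mul (h : JG P Z) (a b : β) : Integrable (fun ω => Z a ω * Z b ω) P :=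
  (h.memLp a).integrable_mul (h.memLp b)

open scoped Nat in
lemma JG.moment (h : JG P Z) (t : β → ℝ) (m : ℕ) :
    ∫ ω, (∑ b, t b * Z b ω) ^ (2 * m) ∂P =
      ((2 * m - 1 : ℕ)‼ : ℝ) * (∑ a, ∑ b, t a * t b * ∫ ω, Z a ω * Z b ω ∂P) ^ m := by
  obtain ⟨v, hv⟩ := h.2 t
  have hm : Measurable (fun ω => ∑ b, t b * Z b ω) := by
    have := h.1; fun_prop
  have key : ∀ m : ℕ, ∫ ω, (∑ b, t b * Z b ω) ^ (2 * m) ∂P = ((2 * m - 1 : ℕ)‼ : ℝ) * (v : ℝ) ^ m := by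
    intro m
    rw [← gm v m, ← hv, integral_map hm.aemeasurable (by fun_prop)]
  rw [key m]
  have h1 := key 1
  simp only [mul_one, pow_one] at h1
  have h2 : ∫ ω, (∑ b, t b * Z b ω) ^ 2 ∂P = ∑ a, ∑ b, t a * t b * ∫ ω, Z a ω * Z b ω ∂P := by
    simp_rw [sq, Finset.sum_mul_sum]
    rw [integral_finsetSum _ fun a _ => ?_]
    · refine Finset.sum_congr rfl fun a _ => ?_
      rw [integral_finsetSum _ fun b _ => ?_]
      · refine Finset.sum_congr rfl fun b _ => ?_
        rw [← integral_const_mul]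
        congr 1; funext ω; ring
      · have := (h.int_mul a b).const_mul (t a * t b)
        exact this.congr (ae_of_all _ fun ω => by ring)
    · refine integrable_finsetSum _ fun b _ => ?_
      have := (h.int_mul a b).const_mul (t a * t b)
      exact this.congr (ae_of_all _ fun ω => by ring)
  rw [← h2, h1]
  norm_num [Nat.doubleFactorial]

lemma pow_sum_expand (x : β → ℝ) (t : β → ℝ) (k : ℕ) :
    (∑ b, t b * x b) ^ k = ∑ φ : Fin k → β, (∏ a, x (φ a)) * ∏ a, t (φ a) := by
  rw [Fintype.sum_pow]
  refine Finset.sum_congr rfl fun φ _ => ?_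
  rw [Finset.prod_mul_distrib, mul_comm]

lemma prod_eq_polar (x : β → ℝ) (k : ℕ) (hk : Fintype.card β = k) :
    ∑ ε : β → Bool, (∏ b, sg (ε b)) * (∑ b, sg (ε b) * x b) ^ k =
     2 ^ k * ((k.factorial : ℝ) * ∏ b, x b) := by
  simp_rw [fun ε : β → Bool => pow_sum_expand x (fun b => sg (ε b)) k]
  rw [polar (by simp [hk]) (fun φ : Fin k → β => ∏ a, x (φ a)), hk]
  congr 1
  simp_rw [fun e : Fin k ≃ β => Equiv.prod_comp e x]
  have e0 : Fin k ≃ β := (Fintype.equivFinOfCardEq hk).symm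
  rw [Finset.sum_const, Finset.card_univ, Fintype.card_equiv e0]
  simp

lemma quad_expand (C : β → β → ℝ) (t : β → ℝ) (m : ℕ) :
    (∑ a, ∑ b, t a * t b * C a b) ^ m =
      ∑ φ : Fin m × Bool → β, (∏ l, C (φ (l, false)) (φ (l, true))) * ∏ a, t (φ a) := by
  rw [← Fintype.sum_prod_type', Fintype.sum_pow]
  let E : (Fin m → β × β) ≃ (Fin m × Bool → β) :=
    { toFun := fun g x => if x.2 then (g x.1).2 else (g x.1).1
      invFun := fun φ l => (φ (l, false), φ (l, true))
      left_inv := fun g => by funext l; simp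
      right_inv := fun φ => by funext ⟨l, b⟩; cases b <;> simp }
  rw [← Equiv.sum_comp E]
  refine Finset.sum_congr rfl fun g _ => ?_
  rw [Finset.prod_mul_distrib, mul_comm, Fintype.prod_prod_type]
  congr 1
  refine Finset.prod_congr rfl fun l _ => ?_
  simp [E, mul_comm]

lemma JG.int_prod (h : JG P Z) : Integrable (fun ω => ∏ b, Z b ω) P := by
  have h1 : (fun ω => ∏ b, Z b ω) = fun ω => (2 ^ (Fintype.card β) * ((Fintype.card β).factorial : ℝ))⁻¹ *
      ∑ ε : β → Bool, (∏ b, sg (ε b)) * (∑ b, sg (ε b) * Z b ω) ^ (Fintype.card β) := by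
    funext ω
    rw [prod_eq_polar _ _ rfl]
    have : ((Fintype.card β).factorial : ℝ) ≠ 0 := by positivity
    field_simp
  rw [h1]
  refine Integrable.const_mul (integrable_finsetSum _ fun ε _ => Integrable.const_mul ?_ _) _
  exact h.int_pow (fun b => sg (ε b)) _

open scoped Nat in
lemma JG.wick1 (h : JG P Z) (m : ℕ) (hm : Fintype.card β = 2 * m) :
    ((2 * m).factorial : ℝ) * ∫ ω, ∏ b, Z b ω ∂P =
      ((2 * m - 1 : ℕ)‼ : ℝ) * ∑ e : Fin m × Bool ≃ β,
        ∏ l, ∫ ω, Z (e (l, false)) ω * Z (e (l, true)) ω ∂P := by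
  have h1 : ∫ ω, 2 ^ (2 * m) * (((2 * m).factorial : ℝ) * ∏ b, Z b ω) ∂P =
     2 ^ (2 * m) * (((2 * m - 1 : ℕ)‼ : ℝ) * ∑ e : Fin m × Bool ≃ β,
        ∏ l, ∫ ω, Z (e (l, false)) ω * Z (e (l, true)) ω ∂P) := by
    simp_rw [← prod_eq_polar _ _ hm]
    rw [integral_finsetSum]
    · simp_rw [integral_const_mul, h.moment, quad_expand]
      generalize ((2 * m - 1 : ℕ)‼ : ℝ) = D
      simp_rw [mul_left_comm _ D]
      rw [← Finset.mul_sum]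
      congr 1
      rw [polar (by simp [hm, mul_comm]) (fun ψ : Fin m × Bool → β => ∏ l, ∫ ω, Z (ψ (l, false)) ω * Z (ψ (l, true)) ω ∂P), hm]
    · intro ε _
      exact (h.int_pow (fun b => sg (ε b)) _).const_mul _
  rw [integral_const_mul, integral_const_mul] at h1
  exact mul_left_cancel₀ (by positivity) h1
end wick

lemma ct_ffi {α : Type} [Fintype α] [DecidableEq α] (g : Equiv.Perm α) (m : ℕ)
    (hc : Fintype.card α = 2 * m) (h1 : ∀ i, g (g i) = i) (h2 : ∀ i, g i ≠ i) :
    g.cycleType = Multiset.replicate m 2 := by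
  have hg : g ^ 2 = 1 := by ext i; simp [sq, h1]
  have ho : orderOf g ∣ 2 := orderOf_dvd_of_pow_eq_one hg
  have hall : ∀ b ∈ g.cycleType, b = 2 := by
    intro b hb
    have h3 := Equiv.Perm.dvd_of_mem_cycleType hb
    have h4 := Equiv.Perm.two_le_of_mem_cycleType hb
    have h5 := Nat.le_of_dvd (by norm_num) (h3.trans ho)
    omega
  rw [Multiset.eq_replicate]
  refine ⟨?_, hall⟩
  have hs := Equiv.Perm.sum_cycleType g
  rw [Multiset.eq_replicate_card.2 hall] at hs
  have hsup : g.support = Finset.univ := by ext i; simp [h2]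
  rw [hsup, Finset.card_univ, hc] at hs
  simp at hs
  omega

/-- flip -/
def fl (m : ℕ) : Equiv.Perm (Fin m × Bool) :=
  (Equiv.refl _).prodCongr Equiv.boolNot

lemma fl_apply (m : ℕ) (x : Fin m × Bool) : fl m x = (x.1, !x.2) := rfl

/-- All pairings. -/
def PP (m : ℕ) : Finset (Equiv.Perm (Fin (2 * m))) :=
  Finset.univ.filter fun p => (∀ i, p (p i) = i) ∧ (∀ i, p i ≠ i)

lemma prod_pair {m : ℕ} (C : Fin (2*m) → Fin (2*m) → ℝ) (hC : ∀ a b, C a b = C b a)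
    (e : Fin m × Bool ≃ Fin (2 * m)) :
    ∏ l, C (e (l, false)) (e (l, true)) =
      ∏ i ∈ Finset.univ.filter (fun i => i < e.permCongr (fl m) i), C i (e.permCongr (fl m) i) := by
  rw [Finset.prod_filter, ← Equiv.prod_comp e, Fintype.prod_prod_type]
  refine Finset.prod_congr rfl fun l _ => ?_
  simp only [Equiv.permCongr_apply, Equiv.symm_apply_apply, fl_apply, Fintype.prod_bool, Bool.not_true, Bool.not_false]
  have hne : e (l, false) ≠ e (l, true) := by simp
  rcases lt_or_gt_of_ne hne with h | h
  · simp [h, h.not_gt]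
  · simp [h, h.not_gt]; exact hC _ _

lemma fiber_card {m : ℕ} (p : Equiv.Perm (Fin (2 * m))) (hp : p ∈ PP m) :
    (Finset.univ.filter fun e : Fin m × Bool ≃ Fin (2 * m) => e.permCongr (fl m) = p).card
      = 2 ^ m * m.factorial := by
  have hf1 : ∀ i, fl m (fl m i) = i := fun i => by simp [fl_apply]
  have hf2 : ∀ i, fl m i ≠ i := fun i h => by
    have := congrArg Prod.snd h
    simp [fl_apply] at this
  have hc : Fintype.card (Fin m × Bool) = 2 * m := by simp [mul_comm]
  have hctf := ct_ffi (fl m) m hc hf1 hf2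
  obtain ⟨hp1, hp2⟩ := (Finset.mem_filter.1 hp).2
  have e1 : Fin m × Bool ≃ Fin (2 * m) := Fintype.equivOfCardEq (by simp [mul_comm])
  have hct1 := ct_ffi (e1.permCongr (fl m)) m (by simp) (by simp [fl_apply]) (by
    intro i h
    rw [Equiv.permCongr_apply, ← Equiv.eq_symm_apply] at h
    exact hf2 _ h)
  have hctp := ct_ffi p m (by simp) hp1 hp2
  obtain ⟨c, hcc⟩ := isConj_iff.1 (Equiv.Perm.isConj_iff_cycleType_eq.2 (hct1.trans hctp.symm))
  have hcc' : ∀ i, c (e1 (fl m (e1.symm (c.symm i)))) = p i := by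
    intro i
    have := congrArg (fun q : Equiv.Perm (Fin (2*m)) => q i) hcc
    simpa using this
  have hcen := Equiv.Perm.nat_card_centralizer (fl m)
  rw [hctf] at hcen
  have hcen2 : Nat.card (Subgroup.centralizer {fl m}) = 2 ^ m * m.factorial := by
    rw [hcen]
    rcases Nat.eq_zero_or_pos m with rfl | hm
    · simp
    · simp [Multiset.toFinset_replicate, hm.ne', mul_comm, Multiset.count_replicate]
  rw [← hcen2, ← Fintype.card_subtype, ← Nat.card_eq_fintype_card]
  symm
  refine Nat.card_congr
    { toFun := fun τ => ⟨(τ.1.trans e1).trans c, ?_⟩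
      invFun := fun e => ⟨e.1.trans (e1.trans c).symm, ?_⟩
      left_inv := ?_
      right_inv := ?_ }
  · ext i
    have ht : ∀ x, fl m (τ.1 x) = τ.1 (fl m x) := fun x => by
      have := (Subgroup.mem_centralizer_singleton_iff.1 τ.2)
      exact (congrArg (fun q : Equiv.Perm (Fin m × Bool) => q x) this).symm
    rw [← hcc' i]
    simp [← ht]
  · rw [Subgroup.mem_centralizer_singleton_iff]
    ext1 x
    have h3 : ∀ x, e.1 (fl m x) = p (e.1 x) := fun x => by
      have := congrArg (fun q : Equiv.Perm (Fin (2*m)) => q (e.1 x)) e.2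
      simpa using this
    simp only [Equiv.Perm.mul_apply, Equiv.trans_apply]
    rw [h3, Equiv.symm_apply_eq, ← hcc']
    simp
  · intro τ; ext1; ext1 x; simp
  · intro e; ext1; ext1 x; simp

lemma sum_pairings {m : ℕ} (C : Fin (2*m) → Fin (2*m) → ℝ) (hC : ∀ a b, C a b = C b a) :
    ∑ e : Fin m × Bool ≃ Fin (2 * m), ∏ l, C (e (l, false)) (e (l, true)) =
      2 ^ m * m.factorial * ∑ p ∈ PP m, ∏ i ∈ Finset.univ.filter (fun i => i < p i), C i (p i) := by
  simp_rw [prod_pair C hC]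
  have hmap : ∀ e ∈ (Finset.univ : Finset (Fin m × Bool ≃ Fin (2 * m))), e.permCongr (fl m) ∈ PP m := by
    intro e _
    refine Finset.mem_filter.2 ⟨Finset.mem_univ _, by simp [fl_apply], ?_⟩
    intro i h
    rw [Equiv.permCongr_apply, ← Equiv.eq_symm_apply] at h
    have := congrArg Prod.snd h
    simp [fl_apply] at this
  rw [← Finset.sum_fiberwise_of_maps_to hmap, Finset.mul_sum]
  refine Finset.sum_congr rfl fun p hp => ?_
  rw [Finset.sum_congr rfl (g := fun _ => ∏ i ∈ Finset.univ.filter (fun i => i < p i), C i (p i))]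
  · rw [Finset.sum_const, fiber_card p hp]; simp
  · intro e he
    rw [(Finset.mem_filter.1 he).2]

open scoped Nat in
lemma fact_df (m : ℕ) : ((2 * m).factorial : ℝ) = ((2 * m - 1 : ℕ)‼ : ℝ) * (2 ^ m * m.factorial) := by
  rcases m with _ | m
  · simp
  · have h := Nat.factorial_eq_mul_doubleFactorial (2 * m + 1)
    have h2 := Nat.doubleFactorial_two_mul (m + 1)
    have h3 : 2 * (m+1) - 1 = 2 * m + 1 := by omega
    rw [h3, show 2 * (m+1) = 2 * m + 1 + 1 by ring, h, ← show 2 * (m+1) = 2 * m + 1 + 1 by ring, h2]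
    push_cast; ring

lemma JG.wick {Ω : Type} [MeasurableSpace Ω] {P : Measure Ω} [IsProbabilityMeasure P] {m : ℕ}
    {Z : Fin (2 * m) → Ω → ℝ} (h : JG P Z) :
    ∫ ω, ∏ b, Z b ω ∂P = ∑ p ∈ PP m, ∏ i ∈ Finset.univ.filter (fun i => i < p i),
      ∫ ω, Z i ω * Z (p i) ω ∂P := by
  have h1 := h.wick1 m (by simp)
  rw [sum_pairings (fun a b => ∫ ω, Z a ω * Z b ω ∂P) (fun a b => by simp_rw [mul_comm]), fact_df] at h1
  refine mul_left_cancel₀ (a := ((2 * m - 1 : ℕ).doubleFactorial : ℝ) * (2 ^ m * m.factorial)) ?_ (h1.trans (by ring))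
  positivity

lemma path_expand {ι : Type} [Fintype ι] [DecidableEq ι] (A : Matrix ι ι ℝ) (k : ℕ) (a b : ι) :
    (A ^ k) a b = ∑ x : Fin (k + 1) → ι, (if x 0 = a ∧ x (Fin.last k) = b then
      ∏ t : Fin k, A (x t.castSucc) (x t.succ) else 0) := by
  induction k generalizing a with
  | zero =>
    rw [← Equiv.sum_comp (Equiv.funUnique (Fin 1) ι).symm]
    simp only [pow_zero, Matrix.one_apply]
    by_cases h : a = b
    · subst h; simp
    · rw [if_neg h, Finset.sum_eq_zero]
      intro x _
      rw [if_neg]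
      rintro ⟨h1, h2⟩
      exact h (h1.symm.trans h2)
  | succ k ih =>
    rw [pow_succ', Matrix.mul_apply]
    rw [← Equiv.sum_comp (Fin.consEquiv (fun _ : Fin (k+2) => ι)), Fintype.sum_prod_type]
    simp only [Fin.consEquiv_apply, Fin.cons_zero]
    symm
    rw [Finset.sum_eq_single a]
    · simp_rw [ih, Finset.mul_sum]
      conv_rhs => rw [Finset.sum_comm]
      refine Finset.sum_congr rfl fun x _ => ?_
      rw [Finset.sum_eq_single (x 0)]
      · rw [Fin.prod_univ_succ]
        simp [← Fin.succ_last]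
      · intro c _ hc
        simp [Ne.symm hc]
      · simp
    · intro c _ hc; simp [hc]
    · simp

lemma trace_pow_cyc {ι : Type} [Fintype ι] [DecidableEq ι] (A : Matrix ι ι ℝ) (n : ℕ) (hn : n ≠ 0) :
    (A ^ n).trace = ∑ x : Fin n → ι, ∏ j, A (x j) (x (finRotate n j)) := by
  obtain ⟨k, rfl⟩ := Nat.exists_eq_succ_of_ne_zero hn
  simp only [Matrix.trace, Matrix.diag, path_expand]
  rw [Finset.sum_comm, ← Equiv.sum_comp (Fin.snocEquiv (fun _ : Fin (k.succ+1) => ι)), Fintype.sum_prod_type, Finset.sum_comm]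
  refine Finset.sum_congr rfl fun x _ => ?_
  have h0 : ∀ y : ι, (Fin.snoc x y : Fin (k.succ + 1) → ι) 0 = x 0 := fun y => by
    rw [← Fin.castSucc_zero, Fin.snoc_castSucc (α := fun _ => ι)]
  simp only [Fin.snocEquiv_apply, Fin.snoc_last, Fin.snoc_castSucc, h0]
  rw [Finset.sum_eq_single (x 0)]
  · rw [Finset.sum_eq_single (x 0)]
    · simp only [and_self, if_true]
      refine Finset.prod_congr rfl fun j _ => ?_
      congr 1
      refine Fin.lastCases ?_ (fun i => ?_) j
      · rw [Fin.succ_last]; simp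
      · rw [Fin.succ_castSucc, Fin.snoc_castSucc (α := fun _ => ι)]
        rw [finRotate_apply, Fin.coeSucc_eq_succ]
    · intro c _ hc; simp [Ne.symm hc]
    · simp
  · intro c _ hc
    refine Finset.sum_eq_zero fun d _ => if_neg ?_
    rintro ⟨h1, h2⟩
    exact hc (h2.trans h1.symm)
  · simp

lemma esd_pow {N : ℕ} (A : Matrix (Fin N) (Fin N) ℝ) (hA : A.IsHermitian) (k : ℕ) :
    ∑ j, (hA.eigenvalues j) ^ k = (A ^ k).trace := by
  have h := hA.spectral_theorem
  conv_rhs => rw [h]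
  rw [← map_pow, Unitary.conjStarAlgAut_apply, Matrix.trace_mul_cycle]
  simp [Matrix.diagonal_pow, Matrix.trace_diagonal]

section
set_option linter.unusedSectionVars false
variable {Ω : Type} [MeasurableSpace Ω] (P : Measure Ω) (X : ℤ → ℤ → Ω → ℝ)

/-- covariance -/
noncomputable def rr (u v : ℤ) : ℝ := ∫ ω, X 0 0 ω * X u v ω ∂P

/-- symmetrized covariance -/
noncomputable def QQ (u v : ℤ) : ℝ := rr P X u v + rr P X v u

/-- symmetrized process -/
def YY (i j : ℤ) (ω : Ω) : ℝ := X i j ω + X j i ω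

variable {P X}

lemma JG_X (hX : StatGauss P X) {β : Type} [Fintype β] (I : β → ℤ × ℤ) :
    JG P (fun b => X (I b).1 (I b).2) := by
  classical
  refine ⟨fun b => hX.meas _ _, fun t => ?_⟩
  obtain ⟨v, hv⟩ := hX.gauss (∑ b, t b • Finsupp.single (I b) 1)
  refine ⟨v, ?_⟩
  rw [← hv]
  congr 1
  funext ω
  have h : ∀ c : (ℤ × ℤ) →₀ ℝ, ∑ p ∈ c.support, c p * X p.1 p.2 ω =
      Finsupp.linearCombination ℝ (fun p : ℤ × ℤ => X p.1 p.2 ω) c := fun c => by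
    simp [Finsupp.linearCombination_apply, Finsupp.sum]
  rw [h, map_sum]
  simp

lemma JG_Y (hX : StatGauss P X) {β : Type} [Fintype β] (I J : β → ℤ) :
    JG P (fun b => YY X (I b) (J b)) := by
  refine ⟨fun b => (hX.meas _ _).add (hX.meas _ _), fun t => ?_⟩
  obtain ⟨v, hv⟩ := (JG_X hX (fun b : β ⊕ β => Sum.elim (fun b => (I b, J b)) (fun b => (J b, I b)) b)).2
    (Sum.elim t t)
  refine ⟨v, ?_⟩
  rw [← hv]
  congr 1
  funext ω
  simp [YY, mul_add, Finset.sum_add_distrib]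

lemma cov_X (hX : StatGauss P X) (i j k l : ℤ) :
    ∫ ω, X i j ω * X k l ω ∂P = rr P X (k - i) (l - j) := by
  have := hX.stat i j (k - i) (l - j)
  simpa [rr] using this

lemma int_X [IsProbabilityMeasure P] (hX : StatGauss P X) (i j k l : ℤ) : Integrable (fun ω => X i j ω * X k l ω) P :=
  (JG_X hX (fun b : Bool => if b then (i, j) else (k, l))).int_mul true false

lemma cov_Y [IsProbabilityMeasure P] (hX : StatGauss P X) (i j k l : ℤ) :
    ∫ ω, YY X i j ω * YY X k l ω ∂P = QQ P X (k - i) (l - j) + QQ P X (l - i) (k - j) := by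
  have : ∀ ω, YY X i j ω * YY X k l ω = (X i j ω * X k l ω + X j i ω * X l k ω) +
     (X i j ω * X l k ω + X j i ω * X k l ω) := fun ω => by simp only [YY]; ring
  simp_rw [this]
  rw [integral_add, integral_add, integral_add]
  · simp only [cov_X hX, QQ]
  all_goals first | exact int_X hX _ _ _ _ | exact (int_X hX _ _ _ _).add (int_X hX _ _ _ _)

lemma rr_even (hX : StatGauss P X) (u v : ℤ) : rr P X (-u) (-v) = rr P X u v := by
  have h := cov_X hX u v 0 0
  have h2 := cov_X hX 0 0 u v
  simp only [zero_sub, sub_zero] at h h2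
  rw [← h, ← h2]
  simp_rw [mul_comm]

/-- the integrand attached to a pairing -/
noncomputable def tm (Q : ℤ → ℤ → ℝ) {m : ℕ} (p : Equiv.Perm (Fin (2 * m))) (ξ : Fin (2 * m) → ℤ) : ℝ :=
  ∏ i ∈ Finset.univ.filter (fun i => i < p i),
    (Q (ξ (p i) - ξ i) (ξ (finRotate _ (p i)) - ξ (finRotate _ i)) +
     Q (ξ (finRotate _ (p i)) - ξ i) (ξ (p i) - ξ (finRotate _ i)))

lemma herm_W (X : ℤ → ℤ → Ω → ℝ) (N : ℕ) (ω : Ω) : (scaledW X N ω).IsHermitian := by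
  ext i j
  simp [scaledW, add_comm]

lemma esd_W (X : ℤ → ℤ → Ω → ℝ) (N : ℕ) (ω : Ω) (m : ℕ) (hm : 1 ≤ m) :
    esdEval (scaledW X N ω) (fun x => x ^ (2 * m)) =
      ((N : ℝ) ^ (m + 1))⁻¹ * ∑ x : Fin (2 * m) → Fin N,
        ∏ j, YY X ((x j : ℕ) + 1) ((x (finRotate _ j) : ℕ) + 1) ω := by
  rw [esdEval, dif_pos (herm_W X N ω), esd_pow, trace_pow_cyc _ _ (by omega)]
  have h : ∀ x : Fin (2 * m) → Fin N, ∏ j, scaledW X N ω (x j) (x (finRotate _ j)) =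
     ((N : ℝ) ^ m)⁻¹ * ∏ j, YY X ((x j : ℕ) + 1) ((x (finRotate _ j) : ℕ) + 1) ω := by
    intro x
    simp only [scaledW, Finset.prod_mul_distrib, YY]
    congr 1
    simp [pow_mul]
  simp_rw [h]
  rw [← Finset.mul_sum, ← mul_assoc, ← mul_inv, pow_succ']

lemma int_W [IsProbabilityMeasure P] (hX : StatGauss P X) (N m : ℕ) (hm : 1 ≤ m) :
    Integrable (fun ω => esdEval (scaledW X N ω) (fun x => x ^ (2 * m))) P := by
  simp_rw [fun ω => esd_W X N ω m hm]
  refine Integrable.const_mul (integrable_finsetSum _ fun x _ => ?_) _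
  exact (JG_Y hX (fun j => ((x j : ℕ) : ℤ) + 1) (fun j => ((x (finRotate _ j) : ℕ):ℤ) + 1)).int_prod

lemma mean_W [IsProbabilityMeasure P] (hX : StatGauss P X) (N m : ℕ) (hm : 1 ≤ m) :
    ∫ ω, esdEval (scaledW X N ω) (fun x => x ^ (2 * m)) ∂P =
      ∑ p ∈ PP m, ((N : ℝ) ^ (m + 1))⁻¹ * ∑ x : Fin (2 * m) → Fin N,
        tm (QQ P X) p (fun j => ((x j : ℕ) : ℤ)) := by
  simp_rw [fun ω => esd_W X N ω m hm]
  rw [integral_const_mul, ← Finset.mul_sum, Finset.sum_comm, integral_finsetSum]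
  · congr 1
    refine Finset.sum_congr rfl fun x _ => ?_
    rw [(JG_Y hX (fun j => ((x j : ℕ) : ℤ) + 1) (fun j => ((x (finRotate _ j) : ℕ):ℤ) + 1)).wick]
    refine Finset.sum_congr rfl fun p _ => ?_
    refine Finset.prod_congr rfl fun i _ => ?_
    rw [cov_Y hX]
    simp
  · intro x _
    exact (JG_Y hX (fun j => ((x j : ℕ) : ℤ) + 1) (fun j => ((x (finRotate _ j) : ℕ):ℤ) + 1)).int_prod
end

/-- periodic extension -/
def zx {R : Type} {m : ℕ} (hm : 0 < 2 * m) (ξ : Fin (2 * m) → R) (j : ℕ) : R :=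
  ξ ⟨j % (2 * m), Nat.mod_lt _ hm⟩

lemma zx_val {R : Type} {m : ℕ} (hm : 0 < 2 * m) (ξ : Fin (2 * m) → R) (i : Fin (2 * m)) :
    zx hm ξ i = ξ i := by
  simp [zx, Nat.mod_eq_of_lt i.2]

lemma zx_succ {R : Type} {m : ℕ} (hm : 0 < 2 * m) (ξ : Fin (2 * m) → R) (i : Fin (2 * m)) :
    zx hm ξ ((i : ℕ) + 1) = ξ (finRotate _ i) := by
  have : NeZero (2 * m) := ⟨hm.ne'⟩
  unfold zx
  congr 1
  ext
  rw [finRotate_apply, Fin.val_add]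
  simp

lemma zx_add {R : Type} {m : ℕ} (hm : 0 < 2 * m) (ξ : Fin (2 * m) → R) (j : ℕ) :
    zx hm ξ (j + 2 * m) = zx hm ξ j := by
  simp [zx]

lemma walk_const {R : Type} (f : ℕ → R) (i k : ℕ) (hik : i ≤ k)
    (h : ∀ j, i ≤ j → j < k → f (j + 1) = f j) : f k = f i := by
  induction k, hik using Nat.le_induction with
  | base => rfl
  | succ k hk ih =>
    rw [h k hk (Nat.lt_succ_self k)]
    exact ih fun j h1 h2 => h j h1 (h2.trans (Nat.lt_succ_self k))

/-- constraints: zero offsets -/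
def zoff {m : ℕ} (p : Equiv.Perm (Fin (2 * m))) (H : Finset (Fin (2 * m))) (z : Fin (2 * m) → ℤ) : Prop :=
  ∀ i, i < p i → (i ∈ H → z (p i) = z i ∧ z (finRotate _ (p i)) = z (finRotate _ i)) ∧
    (i ∉ H → z (finRotate _ (p i)) = z i ∧ z (p i) = z (finRotate _ i))

lemma core_inj {m : ℕ} (hm : 0 < 2 * m) (p : Equiv.Perm (Fin (2 * m))) (hp : p ∈ PP m)
    (H : Finset (Fin (2 * m))) (a : Fin (2 * m)) (ha : a < p a)
    (hbad : a ∈ H ∨ (H = ∅ ∧ ∃ b, a < b ∧ b < p a ∧ p a < p b))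
    (z : Fin (2 * m) → ℤ) (hz0 : z ⟨0, hm⟩ = 0) (hz : zoff p H z)
    (hd : ∀ i, i < p i → i ≠ a → z (finRotate _ i) = z i) : z = 0 := by
  obtain ⟨hp1, hp2⟩ := (Finset.mem_filter.1 hp).2
  have hd' : ∀ i, i ≠ a → i ≠ p a → z (finRotate _ i) = z i := by
    intro i hia hipa
    rcases lt_or_gt_of_ne (hp2 i) with h | h
    · have h1 : p i < p (p i) := by rwa [hp1]
      have h2 := hd (p i) h1 (fun h' => hipa (by rw [← h', hp1]))
      by_cases hH : p i ∈ H
      · have := (hz (p i) h1).1 hH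
        rw [hp1] at this
        rw [this.1, this.2, h2]
      · have := (hz (p i) h1).2 hH
        rw [hp1] at this
        rw [this.1, this.2, h2]
    · exact hd i h hia
  have hstep : ∀ j : ℕ, j < 2 * m → j ≠ a → j ≠ p a → zx hm z (j + 1) = zx hm z j := by
    intro j hj h1 h2
    have := hd' ⟨j, hj⟩ (fun h => h1 (by rw [← h])) (fun h => h2 (by rw [← h]))
    rw [← zx_succ hm z, ← zx_val hm z ⟨j, hj⟩] at this
    exact this
  have hav : (a : ℕ) < p a := ha
  have hpv : (p a : ℕ) < 2 * m := (p a).2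
  have hda : z (finRotate _ a) = z a := by
    rcases hbad with h | ⟨hH, b, hab, hbp, hpp⟩
    · have h1 := ((hz a ha).1 h).1
      rw [← h1, ← zx_succ hm z, ← zx_val hm z (p a)]
      symm
      refine walk_const _ _ _ (by omega) fun j hj1 hj2 => hstep j (by omega) (by omega) (by omega)
    · have hab' : (a : ℕ) < b := hab
      have hbp' : (b : ℕ) < p a := hbp
      have hpp' : (p a : ℕ) < p b := hpp
      have hpbv : (p b : ℕ) < 2 * m := (p b).2
      have h1 := ((hz b (hbp.trans hpp)).2 (by simp [hH])).1
      have e1 : zx hm z b = zx hm z (a + 1) :=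
        walk_const _ _ _ (by omega) fun j hj1 hj2 => hstep j (by omega) (by omega) (by omega)
      have e2 : zx hm z (2 * m) = zx hm z (p b + 1) :=
        walk_const _ _ _ (by omega) fun j hj1 hj2 => hstep j (by omega) (by omega) (by omega)
      have e3 : zx hm z a = zx hm z 0 :=
        walk_const _ _ _ (by omega) fun j hj1 hj2 => hstep j (by omega) (by omega) (by omega)
      have e4 := zx_add hm z 0
      rw [zero_add] at e4
      rw [← zx_succ hm z, ← zx_val hm z b] at h1
      rw [← zx_succ hm z, ← zx_val hm z a, e3, ← e4, e2, h1, e1]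
  have hdp : z (finRotate _ (p a)) = z (p a) := by
    by_cases hH : a ∈ H
    · have := (hz a ha).1 hH
      rw [this.1, this.2, hda]
    · have := (hz a ha).2 hH
      rw [this.1, this.2, hda]
  funext i
  rw [← zx_val hm z i, walk_const (zx hm z) 0 i (by omega)]
  · simpa [zx] using hz0
  · intro j _ hj
    have hj2 : j < 2 * m := hj.trans i.2
    by_cases h1 : j = a
    · subst h1; rw [zx_succ, zx_val, hda]
    · by_cases h2 : j = p a
      · subst h2; rw [zx_succ, zx_val, hdp]
      · exact hstep j hj2 h1 h2

lemma card_firsts {m : ℕ} (p : Equiv.Perm (Fin (2 * m))) (hp : p ∈ PP m) :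
    (Finset.univ.filter fun i => i < p i).card = m := by
  obtain ⟨hp1, hp2⟩ := (Finset.mem_filter.1 hp).2
  have h1 := Finset.card_filter_add_card_filter_not (s := Finset.univ) (fun i => i < p i)
  have h2 : (Finset.univ.filter fun i => i < p i).card = (Finset.univ.filter fun i => ¬ i < p i).card := by
    refine Finset.card_bij (fun i _ => p i) ?_ (fun i _ j _ h => p.injective h) ?_
    · intro i hi
      have := (Finset.mem_filter.1 hi).2
      simp [hp1, this.le]
    · intro i hi
      have := (Finset.mem_filter.1 hi).2
      refine ⟨p i, ?_, hp1 i⟩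
      simp only [Finset.mem_filter, Finset.mem_univ, true_and, hp1]
      exact lt_of_le_of_ne (not_lt.1 this) (hp2 i)
  simp only [Finset.card_univ, Fintype.card_fin] at h1
  omega

/-- offsets -/
def offs {m : ℕ} (p : Equiv.Perm (Fin (2 * m))) (H : Finset (Fin (2 * m))) (ξ : Fin (2 * m) → ℤ)
    (i : Fin (2 * m)) : ℤ × ℤ :=
  if i ∈ H then (ξ (p i) - ξ i, ξ (finRotate _ (p i)) - ξ (finRotate _ i))
  else (ξ (finRotate _ (p i)) - ξ i, ξ (p i) - ξ (finRotate _ i))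

lemma bad_count {m : ℕ} (hm : 0 < 2 * m) (p : Equiv.Perm (Fin (2 * m))) (hp : p ∈ PP m)
    (H : Finset (Fin (2 * m))) (a : Fin (2 * m)) (ha : a < p a)
    (hbad : a ∈ H ∨ (H = ∅ ∧ ∃ b, a < b ∧ b < p a ∧ p a < p b)) (n N : ℕ) :
    (Finset.univ.filter fun x : Fin (2 * m) → Fin N =>
      ∀ i, i < p i → offs p H (fun j => ((x j : ℕ) : ℤ)) i ∈
        Finset.Icc (-(n:ℤ)) n ×ˢ Finset.Icc (-(n:ℤ)) n).card ≤
      N * ((2 * n + 1) ^ 2) ^ m * (2 * N + 1) ^ (m - 1) := by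
  classical
  let F := Finset.univ.filter fun i => i < p i
  have hF : F.card = m := card_firsts p hp
  have haF : a ∈ F := by simp [F, ha]
  let tgt : Finset (Fin N × (F → ℤ × ℤ) × (F.erase a → ℤ)) :=
    Finset.univ ×ˢ (Fintype.piFinset (fun _ => Finset.Icc (-(n:ℤ)) n ×ˢ Finset.Icc (-(n:ℤ)) n)) ×ˢ
      (Fintype.piFinset (fun _ => Finset.Icc (-(N:ℤ)) N))
  have hcard : tgt.card = N * ((2 * n + 1) ^ 2) ^ m * (2 * N + 1) ^ (m - 1) := by
    have h1 : ∀ n : ℕ, ((n:ℤ) + 1 + n).toNat = 2 * n + 1 := fun n => by omega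
    simp [tgt, Fintype.card_piFinset, hF, Finset.card_erase_of_mem haF, h1, mul_assoc, sq]
  rw [← hcard]
  refine Finset.card_le_card_of_injOn (fun x => (x ⟨0, hm⟩,
    (fun i => offs p H (fun j => ((x j : ℕ) : ℤ)) i.1),
    (fun i => ((x (finRotate _ i.1) : ℕ) : ℤ) - ((x i.1 : ℕ) : ℤ)))) ?_ ?_
  · intro x hx
    have hx := (Finset.mem_filter.1 hx).2
    simp only [tgt, Finset.coe_product, Set.mem_prod, Finset.coe_univ, Set.mem_univ, true_and,
      Finset.mem_coe, Fintype.mem_piFinset]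
    refine ⟨fun i => hx i.1 (by have := i.2; simp only [F, Finset.mem_filter] at this; exact this.2), fun i => ?_⟩
    have h1 := (x (finRotate _ i.1)).2
    have h2 := (x i.1).2
    rw [Finset.mem_Icc]; omega
  · intro x _ y _ hxy
    simp only [Prod.mk.injEq] at hxy
    obtain ⟨h0, h1, h2⟩ := hxy
    have hz := core_inj hm p hp H a ha hbad (fun j => ((x j : ℕ) : ℤ) - ((y j : ℕ):ℤ)) (by simp [h0]) ?_ ?_
    · funext j
      have := congrFun hz j
      simp at this
      ext; omega
    · intro i hi
      have hiF : i ∈ F := by simp [F, hi]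
      have h3 := congrFun h1 ⟨i, hiF⟩
      simp only [offs] at h3
      constructor
      · intro hH
        simp only [hH, if_true, Prod.mk.injEq] at h3
        dsimp only
        omega
      · intro hH
        simp only [hH, if_false, Prod.mk.injEq] at h3
        dsimp only
        omega
    · intro i hi hia
      have hiF : i ∈ F.erase a := by simp [F, hi, hia]
      have h3 := congrFun h2 ⟨i, hiF⟩
      simp only at h3 ⊢
      omega

section cyc
set_option linter.unusedSectionVars false
variable {α : Type} [Fintype α] [DecidableEq α] (g : Equiv.Perm α) (k : α → ℤ)

/-- partial cycle sums -/
def SS (t : ℕ) (j : α) : ℤ := ∑ l ∈ Finset.range t, k ((g ^ (l + 1)) j)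

lemma SS_add (a b : ℕ) (j : α) : SS g k (a + b) j = SS g k a j + SS g k b ((g ^ a) j) := by
  unfold SS
  rw [Finset.sum_range_add]
  congr 1
  refine Finset.sum_congr rfl fun l _ => ?_
  rw [← Equiv.Perm.mul_apply, ← pow_add]
  congr 3; ring

open Classical in
lemma SS_cycle (hk : ∀ i, ∑ j ∈ Finset.univ.filter (fun j => g.SameCycle i j), k j = 0) (j : α) :
    SS g k (Function.minimalPeriod g j) j = 0 := by
  rw [← hk j, SS]
  have hper : Function.IsPeriodicPt g (Function.minimalPeriod g j) j :=
    Function.isPeriodicPt_minimalPeriod g j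
  have hpos : 0 < Function.minimalPeriod g j := by
    apply Function.minimalPeriod_pos_of_mem_periodicPts
    exact Function.Injective.mem_periodicPts g.injective j
  have hmod : ∀ l : ℕ, (g ^ (l % Function.minimalPeriod g j)) j = (g ^ l) j := by
    intro l
    rw [Equiv.Perm.coe_pow, Equiv.Perm.coe_pow]
    exact Function.iterate_mod_minimalPeriod_eq
  refine Finset.sum_nbij (fun l => (g ^ (l + 1)) j) ?_ ?_ ?_ ?_
  · intro l _
    simp [Equiv.Perm.SameCycle.refl]
  · intro a ha b hb hab
    simp only [pow_succ', Equiv.Perm.mul_apply, EmbeddingLike.apply_eq_iff_eq] at hab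
    simp only [Equiv.Perm.coe_pow] at hab
    exact Function.iterate_injOn_Iio_minimalPeriod (by simpa using ha) (by simpa using hb) hab
  · intro i hi
    have hi' : g.SameCycle j i := by simpa using hi
    obtain ⟨l, hl⟩ := hi'.exists_nat_pow_eq
    set c := Function.minimalPeriod g j with hc
    have hlt : (l + (c - 1)) % c < c := Nat.mod_lt _ hpos
    refine ⟨(l + (c - 1)) % c, by simpa using hlt, ?_⟩
    show (g ^ ((l + (c - 1)) % c + 1)) j = i
    rw [pow_succ', Equiv.Perm.mul_apply, hmod, ← Equiv.Perm.mul_apply, ← pow_succ', ← hmod]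
    rw [show l + (c - 1) + 1 = l + c by omega, Nat.add_mod_right, hmod, hl]
  · intro l _; rfl

open Classical in
lemma SS_per (hk : ∀ i, ∑ j ∈ Finset.univ.filter (fun j => g.SameCycle i j), k j = 0) (j : α) (d : ℕ)
    (hd : (g ^ d) j = j) : SS g k d j = 0 := by
  have h1 : Function.IsPeriodicPt g d j := by
    rw [Equiv.Perm.coe_pow] at hd; exact hd
  obtain ⟨q, rfl⟩ := h1.minimalPeriod_dvd
  clear hd h1
  induction q with
  | zero => simp [SS]
  | succ q ih =>
    rw [mul_add, mul_one, SS_add, ih]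
    have h2 : (g ^ (Function.minimalPeriod g j * q)) j = j := by
      rw [Equiv.Perm.coe_pow]
      exact (Function.isPeriodicPt_minimalPeriod g j).mul_const q
    rw [h2, SS_cycle g k hk j, add_zero]

open Classical in
lemma SS_eq (hk : ∀ i, ∑ j ∈ Finset.univ.filter (fun j => g.SameCycle i j), k j = 0) (j : α) (a b : ℕ)
    (hab : (g ^ a) j = (g ^ b) j) : SS g k a j = SS g k b j := by
  wlog h : a ≤ b generalizing a b
  · exact (this b a hab.symm (le_of_not_ge h)).symm
  obtain ⟨d, rfl⟩ := Nat.exists_eq_add_of_le h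
  rw [SS_add, SS_per g k hk _ d, add_zero]
  rw [← Equiv.Perm.mul_apply, ← pow_add, add_comm, ← hab]

open Classical in
lemma cyc_sol (hk : ∀ i, ∑ j ∈ Finset.univ.filter (fun j => g.SameCycle i j), k j = 0) :
    ∃ y : α → ℤ, ∀ j, y j - y (g j) = k (g j) := by
  let S := Equiv.Perm.SameCycle.setoid g
  let ρ : α → α := fun j => (Quotient.mk S j).out
  have hρ : ∀ j, g.SameCycle (ρ j) j := fun j => Quotient.mk_out (s := S) j
  have hρg : ∀ j, ρ (g j) = ρ j := by
    intro j
    have : Quotient.mk S (g j) = Quotient.mk S j := Quotient.sound (s := S) (by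
      show g.SameCycle (g j) j
      simp [Equiv.Perm.SameCycle.refl])
    simp only [ρ, this]
  choose t ht using fun j => (hρ j).exists_nat_pow_eq
  refine ⟨fun j => - SS g k (t j) (ρ j), fun j => ?_⟩
  have h1 : SS g k (t (g j)) (ρ (g j)) = SS g k (t j + 1) (ρ j) := by
    rw [hρg]
    apply SS_eq g k hk
    rw [← hρg j, ht, hρg, pow_succ', Equiv.Perm.mul_apply, ht]
  show - SS g k (t j) (ρ j) - - SS g k (t (g j)) (ρ (g j)) = k (g j)
  rw [h1, SS_add, ht]
  simp [SS]

open Classical in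
/-- number of cycles -/
noncomputable def nc : ℕ := Fintype.card (Quotient (Equiv.Perm.SameCycle.setoid g))

open Classical in
/-- solution count -/
noncomputable def cnt (N : ℕ) : ℕ :=
  (Finset.univ.filter fun y : α → Fin N => ∀ j, ((y j : ℕ) : ℤ) - ((y (g j) : ℕ) : ℤ) = k (g j)).card

lemma const_cyc {R : Type} (d : α → R) (hd : ∀ j, d (g j) = d j) {i j : α} (h : g.SameCycle i j) : d i = d j := by
  obtain ⟨l, hl⟩ := h.exists_nat_pow_eq
  rw [← hl]
  clear hl
  induction l with
  | zero => simp
  | succ l ih => rw [pow_succ', Equiv.Perm.mul_apply, hd, ih]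

lemma cnt_le (N : ℕ) : cnt g k N ≤ N ^ nc g := by
  classical
  have : N ^ nc g = (Finset.univ : Finset (Quotient (Equiv.Perm.SameCycle.setoid g) → Fin N)).card := by
    simp [nc]
  rw [this]
  refine Finset.card_le_card_of_injOn (fun y q => y q.out) (by simp) ?_
  intro y hy y' hy' h
  have hy := (Finset.mem_filter.1 hy).2
  have hy' := (Finset.mem_filter.1 hy').2
  funext j
  have h1 := const_cyc g (fun j => ((y j : ℕ) : ℤ) - ((y' j : ℕ) : ℤ)) (fun j => by
    have := hy j; have := hy' j; omega)
    (Quotient.mk_out (s := Equiv.Perm.SameCycle.setoid g) j)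
  have h2 := congrFun h (Quotient.mk (Equiv.Perm.SameCycle.setoid g) j)
  simp only at h1 h2
  rw [h2] at h1
  ext; omega

lemma le_cnt (y0 : α → ℤ) (h0 : ∀ j, y0 j - y0 (g j) = k (g j)) (B : ℕ) (hB : ∀ j, |y0 j| ≤ B) (N : ℕ) :
    (N - 2 * B) ^ nc g ≤ cnt g k N := by
  classical
  have : (N - 2 * B) ^ nc g = (Finset.univ : Finset (Quotient (Equiv.Perm.SameCycle.setoid g) → Fin (N - 2 * B))).card := by
    simp [nc]
  rw [this]
  have hb : ∀ (w : Fin (N - 2 * B)) (j : α), ((w : ℕ) + B + y0 j).toNat < N := fun w j => by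
    have := w.2; have := abs_le.1 (hB j); omega
  have hb2 : ∀ (w : Fin (N - 2 * B)) (j : α), ((((w : ℕ) + B + y0 j).toNat : ℕ) : ℤ) = (w : ℕ) + B + y0 j := fun w j => by
    have := abs_le.1 (hB j); omega
  refine Finset.card_le_card_of_injOn (fun w j => ⟨((w (Quotient.mk _ j) : ℕ) + B + y0 j).toNat, hb _ _⟩) ?_ ?_
  · intro w _
    simp only [Finset.coe_filter, Finset.mem_univ, true_and, Set.mem_ofPred_eq]
    intro j
    rw [hb2, hb2, ← h0]
    have : Quotient.mk (Equiv.Perm.SameCycle.setoid g) (g j) = Quotient.mk (Equiv.Perm.SameCycle.setoid g) j :=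
      Quotient.sound (s := Equiv.Perm.SameCycle.setoid g) (by
      show g.SameCycle (g j) j
      simp [Equiv.Perm.SameCycle.refl])
    rw [this]; ring
  · intro w _ w' _ h
    funext q
    induction q using Quotient.inductionOn with
    | h j =>
      have h1 := congrArg (fun f => ((f j : ℕ) : ℤ)) h
      simp only [hb2] at h1
      ext; omega

open Classical in
lemma cnt_lim (hk : ∀ i, ∑ j ∈ Finset.univ.filter (fun j => g.SameCycle i j), k j = 0) :
    Tendsto (fun N : ℕ => ((N : ℝ) ^ nc g)⁻¹ * cnt g k N) atTop (nhds 1) := by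
  obtain ⟨y0, h0⟩ := cyc_sol g k hk
  obtain ⟨B, hB⟩ : ∃ B : ℕ, ∀ j, |y0 j| ≤ B := by
    refine ⟨∑ j, (y0 j).natAbs, fun j => ?_⟩
    have := Finset.single_le_sum (f := fun j => (y0 j).natAbs) (fun _ _ => Nat.zero_le _) (Finset.mem_univ j)
    rw [Int.abs_eq_natAbs]
    exact_mod_cast this
  have hl : Tendsto (fun N : ℕ => (1 - (2 * B : ℝ) * (N : ℝ)⁻¹) ^ nc g) atTop (nhds 1) := by
    have : Tendsto (fun N : ℕ => (N : ℝ)⁻¹) atTop (nhds 0) := tendsto_inv_atTop_nhds_zero_nat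
    have := ((this.const_mul (2 * B : ℝ)).const_sub 1).pow (nc g)
    simpa using this
  refine tendsto_of_tendsto_of_tendsto_of_le_of_le' hl tendsto_const_nhds ?_ ?_
  · filter_upwards [eventually_ge_atTop (2 * B + 1)] with N hN
    have hN0 : (0:ℝ) < N := by exact_mod_cast (by omega : 0 < N)
    have h1 : (((N - 2 * B : ℕ) : ℝ)) ^ nc g ≤ cnt g k N := by exact_mod_cast le_cnt g k y0 h0 B hB N
    rw [Nat.cast_sub (by omega)] at h1
    push_cast at h1
    rw [inv_mul_eq_div, le_div_iff₀ (by positivity), ← mul_pow]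
    rw [show (1 - (2 * B : ℝ) * (N : ℝ)⁻¹) * N = N - 2 * B by field_simp]
    exact h1
  · filter_upwards [eventually_ge_atTop 1] with N hN
    have hN0 : (0:ℝ) < N := by exact_mod_cast (by omega : 0 < N)
    have h1 : (cnt g k N : ℝ) ≤ (N : ℝ) ^ nc g := by exact_mod_cast cnt_le g k N
    rw [inv_mul_eq_div, div_le_one (by positivity)]
    exact h1

open Classical in
lemma cnt_zero (hk : ¬ ∀ i, ∑ j ∈ Finset.univ.filter (fun j => g.SameCycle i j), k j = 0) (N : ℕ) :
    cnt g k N = 0 := by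
  unfold cnt
  rw [Finset.card_eq_zero, Finset.filter_eq_empty_iff]
  intro y _ hy
  apply hk
  intro i
  have hre : ∀ f : α → ℤ, ∑ j ∈ Finset.univ.filter (fun j => g.SameCycle i j), f (g j) =
      ∑ j ∈ Finset.univ.filter (fun j => g.SameCycle i j), f j := by
    intro f
    refine Finset.sum_equiv g ?_ (fun _ _ => rfl)
    intro j; simp
  rw [← hre k, Finset.sum_congr rfl (fun j _ => (hy j).symm), Finset.sum_sub_distrib,
    hre (fun j => ((y j : ℕ) : ℤ)), sub_self]
end cyc

/-- solutions mod 2 -/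
def Sol2 {m : ℕ} (p : Equiv.Perm (Fin (2 * m))) : Type :=
  {x : Fin (2 * m) → ZMod 2 // ∀ v, x (p v) = x (finRotate _ v)}

noncomputable instance {m : ℕ} (p : Equiv.Perm (Fin (2 * m))) : Fintype (Sol2 p) := by
  classical
  unfold Sol2; infer_instance

lemma Sol2_card1 {m : ℕ} (p : Equiv.Perm (Fin (2 * m))) (hp1 : ∀ i, p (p i) = i) :
    Fintype.card (Sol2 p) = 2 ^ nc (krewPerm m p) := by
  classical
  have : (2 : ℕ) ^ nc (krewPerm m p) =
    Fintype.card (Quotient (Equiv.Perm.SameCycle.setoid (krewPerm m p)) → ZMod 2) := by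
    simp [nc]
  rw [this]
  symm
  let Φ : (Quotient (Equiv.Perm.SameCycle.setoid (krewPerm m p)) → ZMod 2) → Sol2 p :=
    fun w => ⟨fun j => w (Quotient.mk _ ((finRotate _).symm j)), fun v => by
      refine congrArg w (Quotient.sound (s := Equiv.Perm.SameCycle.setoid (krewPerm m p)) ?_)
      show (krewPerm m p).SameCycle _ _
      refine ⟨1, ?_⟩
      rw [zpow_one, krewPerm, Equiv.trans_apply, Equiv.apply_symm_apply, hp1, Equiv.symm_apply_apply]⟩
  refine Fintype.card_of_bijective (f := Φ) ⟨?_, ?_⟩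
  · intro w w' h
    funext q
    induction q using Quotient.inductionOn with
    | h j =>
      have := congrFun (congrArg Subtype.val h) (finRotate _ j)
      simpa only [Φ, Equiv.symm_apply_apply] using this
  · intro x
    refine ⟨fun q => x.1 (finRotate _ q.out), ?_⟩
    apply Subtype.ext
    funext j
    have := const_cyc (krewPerm m p) (fun j => x.1 (finRotate _ j)) (fun j => by
      have := x.2 (p (finRotate _ j))
      rw [hp1] at this
      exact this.symm) (Quotient.mk_out (s := Equiv.Perm.SameCycle.setoid (krewPerm m p)) ((finRotate _).symm j))
    simpa only [Φ, Equiv.apply_symm_apply] using this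

lemma Sol2_card2 {m : ℕ} (hm : 0 < 2 * m) (p : Equiv.Perm (Fin (2 * m))) (hp : p ∈ NCPairings m) :
    Fintype.card (Sol2 p) = 2 ^ (m + 1) := by
  classical
  obtain ⟨hp1, hp2, hp3⟩ := (Finset.mem_filter.1 hp).2
  have hPP : p ∈ PP m := by simp only [PP, Finset.mem_filter, Finset.mem_univ, true_and]; exact ⟨hp1, hp2⟩
  let F := Finset.univ.filter fun i => i < p i
  have hF : F.card = m := card_firsts p hPP
  have : 2 ^ (m + 1) = Fintype.card (ZMod 2 × (F → ZMod 2)) := by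
    simp [hF, pow_succ, mul_comm]
  rw [this]
  refine Fintype.card_of_bijective (f := fun x : Sol2 p =>
    ((x.1 ⟨0, hm⟩, fun i : F => x.1 (finRotate _ i.1) - x.1 i.1) : ZMod 2 × (F → ZMod 2))) ⟨?_, ?_⟩
  · intro x x' h
    apply Subtype.ext
    simp only [Prod.mk.injEq] at h
    have hfirst : ∀ i, i < p i → x.1 (finRotate _ i) - x.1 i = x'.1 (finRotate _ i) - x'.1 i := fun i hi =>
      congrFun h.2 ⟨i, by simp [F, hi]⟩
    have hall : ∀ i, x.1 (finRotate _ i) - x.1 i = x'.1 (finRotate _ i) - x'.1 i := by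
      intro i
      rcases lt_or_gt_of_ne (hp2 i) with h | h
      · have h1 := hfirst (p i) (by rwa [hp1])
        have a1 := x.2 i
        have a2 := x.2 (p i)
        have b1 := x'.2 i
        have b2 := x'.2 (p i)
        rw [hp1] at a2 b2
        rw [← a2, ← b2, a1, b1] at h1
        linear_combination -h1
      · exact hfirst i h
    have hstep : ∀ j : ℕ, j < 2 * m → zx hm (fun i => x.1 i - x'.1 i) (j + 1) = zx hm (fun i => x.1 i - x'.1 i) j := by
      intro j hj
      have h1 := zx_succ hm (fun i => x.1 i - x'.1 i) ⟨j, hj⟩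
      have h2 := zx_val hm (fun i => x.1 i - x'.1 i) ⟨j, hj⟩
      simp only at h1 h2
      rw [h1, h2]
      linear_combination hall ⟨j, hj⟩
    funext i
    have h1 := walk_const (zx hm (fun i => x.1 i - x'.1 i)) 0 i (Nat.zero_le _)
      (fun j _ hj => hstep j (hj.trans i.2))
    rw [zx_val] at h1
    have h2 := zx_val hm (fun i => x.1 i - x'.1 i) ⟨0, hm⟩
    simp only at h2
    rw [h2, h.1, sub_self] at h1
    exact sub_eq_zero.1 h1
  · rintro ⟨c, d⟩
    let δ : Fin (2 * m) → ZMod 2 := fun j => if hj : j ∈ F then d ⟨j, hj⟩ else if hj : p j ∈ F then d ⟨p j, hj⟩ else 0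
    have memF : ∀ j, j ∈ F ↔ j < p j := fun j => by simp [F]
    have hδF : ∀ j (hj : j ∈ F), δ j = d ⟨j, hj⟩ := fun j hj => by simp [δ, hj]
    have hδp' : ∀ j, j < p j → δ (p j) = δ j := by
      intro j hj
      have h1 : j ∈ F := (memF j).2 hj
      have h2 : p j ∉ F := by rw [memF, hp1]; exact hj.le.not_gt
      rw [hδF j h1]
      simp only [δ, h2, dif_neg, not_false_eq_true, hp1, h1, dif_pos]
    have hδp : ∀ j, δ (p j) = δ j := by
      intro j
      rcases lt_or_gt_of_ne (hp2 j) with h | h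
      · have := hδp' (p j) (by rwa [hp1]); rw [hp1] at this; exact this.symm
      · exact hδp' j h
    have hsum0 : ∀ s : Finset (Fin (2 * m)), (∀ i ∈ s, p i ∈ s) → ∑ i ∈ s, δ i = 0 := by
      intro s hs
      refine Finset.sum_involution (fun i _ => p i) ?_ ?_ ?_ ?_
      · intro i _; rw [hδp]; exact CharTwo.add_self_eq_zero _
      · intro i _ _; exact hp2 i
      · intro i hi; exact hs i hi
      · intro i _; exact hp1 i
    let x : Fin (2 * m) → ZMod 2 := fun j => c + ∑ i ∈ Finset.Iio j, δ i
    have : NeZero (2 * m) := ⟨hm.ne'⟩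
    have hxs : ∀ j, x (finRotate _ j) = x j + δ j := by
      intro j
      have hIic : ∑ i ∈ Finset.Iic j, δ i = ∑ i ∈ Finset.Iio j, δ i + δ j := by
        rw [← Finset.Iio_insert, Finset.sum_insert (by simp), add_comm]
      by_cases hj : (j : ℕ) + 1 < 2 * m
      · have h1 : Finset.Iio (finRotate _ j) = Finset.Iic j := by
          ext i
          have : ((finRotate (2 * m) j : Fin (2 * m)) : ℕ) = (j : ℕ) + 1 := by
            rw [finRotate_apply, Fin.val_add_one_of_lt']
            exact hj
          simp only [Finset.mem_Iio, Finset.mem_Iic, Fin.lt_def, Fin.le_def]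
          omega
        simp only [x]
        rw [h1, hIic, add_assoc]
      · have h1 : finRotate (2 * m) j = ⟨0, hm⟩ := by
          ext
          rw [finRotate_apply, Fin.val_add]
          have : (j : ℕ) + 1 = 2 * m := by omega
          simp [this]
        have h2 : Finset.Iic j = Finset.univ := by
          ext i; simp only [Finset.mem_Iic, Fin.le_def, Finset.mem_univ, iff_true]; omega
        have h3 : Finset.Iio (⟨0, hm⟩ : Fin (2 * m)) = ∅ := by
          ext i; simp [Fin.lt_def]
        rw [h2, hsum0 _ (by simp)] at hIic
        simp only [x]
        rw [h1, h3, add_assoc, ← hIic]; simp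
    have key : ∀ v, v < p v → x (p v) = x (finRotate _ v) := by
      intro v hv
      rw [hxs]
      have h1 : Finset.Iio (p v) = Finset.Iio v ∪ {v} ∪ Finset.Ioo v (p v) := by
        ext i
        simp only [Finset.mem_union, Finset.mem_Iio, Finset.mem_singleton, Finset.mem_Ioo, Fin.lt_def, Fin.ext_iff] at hv ⊢
        omega
      have h2 : ∑ i ∈ Finset.Ioo v (p v), δ i = 0 := by
        apply hsum0
        intro i hi
        obtain ⟨a1, a2⟩ := Finset.mem_Ioo.1 hi
        rw [Finset.mem_Ioo]
        have n1 : p i ≠ v := fun h => by rw [← h, hp1] at a2; exact lt_irrefl _ a2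
        have n2 : p i ≠ p v := fun h => a1.ne' (p.injective h)
        constructor
        · by_contra hlt
          have hlt' : p i < v := lt_of_le_of_ne (not_lt.1 hlt) n1
          exact hp3 (p i) v ⟨hlt', by rwa [hp1], by rwa [hp1]⟩
        · by_contra hlt
          have hlt' : p v < p i := lt_of_le_of_ne (not_lt.1 hlt) n2.symm
          exact hp3 v i ⟨a1, a2, hlt'⟩
      simp only [x]
      rw [h1, Finset.sum_union, Finset.sum_union, h2]
      · simp [add_assoc]
      · simp
      · rw [Finset.disjoint_left]
        intro i hi hi'
        simp only [Finset.mem_union, Finset.mem_Iio, Finset.mem_singleton, Finset.mem_Ioo, Fin.lt_def, Fin.ext_iff] at hi hi'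
        omega
    refine ⟨⟨x, fun v => ?_⟩, ?_⟩
    · rcases lt_or_gt_of_ne (hp2 v) with h | h
      · have h1 := key (p v) (by rwa [hp1])
        rw [hp1, hxs] at h1
        rw [hxs, h1, ← hδp v, add_assoc, CharTwo.add_self_eq_zero, add_zero]
      · exact key v h
    · simp only [Prod.mk.injEq]
      constructor
      · have h3 : Finset.Iio (⟨0, hm⟩ : Fin (2 * m)) = ∅ := by
          ext i; simp
        simp only [x]
        rw [h3, Finset.sum_empty, add_zero]
      · funext i
        rw [hxs, hδF i.1 i.2]; simp

lemma nc_krew {m : ℕ} (hm : 0 < 2 * m) (p : Equiv.Perm (Fin (2 * m))) (hp : p ∈ NCPairings m) :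
    nc (krewPerm m p) = m + 1 := by
  have h := Sol2_card1 p (Finset.mem_filter.1 hp).2.1
  rw [Sol2_card2 hm p hp] at h
  exact (Nat.pow_right_injective (le_refl 2) h).symm

/-- product of Q over offsets -/
def pq {m : ℕ} (Q : ℤ → ℤ → ℝ) (p : Equiv.Perm (Fin (2 * m))) (H : Finset (Fin (2 * m))) (ξ : Fin (2 * m) → ℤ) : ℝ :=
  ∏ i ∈ Finset.univ.filter (fun i => i < p i), Q (offs p H ξ i).1 (offs p H ξ i).2

lemma tm_expand {m : ℕ} (Q : ℤ → ℤ → ℝ) (p : Equiv.Perm (Fin (2 * m))) (ξ : Fin (2 * m) → ℤ) :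
    tm Q p ξ = ∑ H ∈ (Finset.univ.filter (fun i => i < p i)).powerset, pq Q p H ξ := by
  unfold tm
  rw [Finset.prod_add]
  refine Finset.sum_congr rfl fun H hH => ?_
  unfold pq
  rw [← Finset.prod_sdiff (Finset.mem_powerset.1 hH), mul_comm]
  congr 1
  · refine Finset.prod_congr rfl fun i hi => ?_
    simp [offs, (Finset.mem_sdiff.1 hi).2]
  · refine Finset.prod_congr rfl fun i hi => ?_
    simp [offs, hi]

lemma bad_lim {m : ℕ} (hm : 1 ≤ m) (Q : ℤ → ℤ → ℝ) (n : ℕ) (B : ℝ)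
    (hQ : ∀ u v, ¬ (u, v) ∈ Finset.Icc (-(n:ℤ)) n ×ˢ Finset.Icc (-(n:ℤ)) n → Q u v = 0)
    (hB : ∀ u v, |Q u v| ≤ B)
    (p : Equiv.Perm (Fin (2 * m))) (hp : p ∈ PP m)
    (H : Finset (Fin (2 * m))) (a : Fin (2 * m)) (ha : a < p a)
    (hbad : a ∈ H ∨ (H = ∅ ∧ ∃ b, a < b ∧ b < p a ∧ p a < p b)) :
    Tendsto (fun N : ℕ => ((N:ℝ)^(m+1))⁻¹ * ∑ x : Fin (2*m) → Fin N, pq Q p H (fun j => ((x j:ℕ):ℤ)))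
      atTop (nhds 0) := by
  classical
  have hB0 : 0 ≤ B := (abs_nonneg _).trans (hB 0 0)
  set K : ℝ := B ^ m * ((2 * n + 1) ^ 2) ^ m * 3 ^ (m - 1) with hK
  have hlim : Tendsto (fun N : ℕ => K * (N:ℝ)⁻¹) atTop (nhds 0) := by
    have : Tendsto (fun N : ℕ => (N : ℝ)⁻¹) atTop (nhds 0) := tendsto_inv_atTop_nhds_zero_nat
    simpa using this.const_mul K
  refine squeeze_zero_norm' ?_ hlim
  filter_upwards [eventually_ge_atTop 1] with N hN
  have hN0 : (0:ℝ) < N := by exact_mod_cast (by omega : 0 < N)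
  have hN1 : (1:ℝ) ≤ N := by exact_mod_cast hN
  have hcount := bad_count (by omega) p hp H a ha hbad n N
  set A := Finset.univ.filter fun x : Fin (2 * m) → Fin N =>
      ∀ i, i < p i → offs p H (fun j => ((x j : ℕ) : ℤ)) i ∈
        Finset.Icc (-(n:ℤ)) n ×ˢ Finset.Icc (-(n:ℤ)) n with hA
  have h1 : |∑ x : Fin (2*m) → Fin N, pq Q p H (fun j => ((x j:ℕ):ℤ))| ≤ A.card * B ^ m := by
    have h2 : ∑ x : Fin (2*m) → Fin N, pq Q p H (fun j => ((x j:ℕ):ℤ)) =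
        ∑ x ∈ A, pq Q p H (fun j => ((x j:ℕ):ℤ)) := by
      symm
      refine Finset.sum_subset (Finset.subset_univ _) ?_
      intro x _ hx
      simp only [hA, Finset.mem_filter, Finset.mem_univ, true_and, not_forall] at hx
      obtain ⟨i, hi, hx⟩ := hx
      exact Finset.prod_eq_zero (i := i) (by simp [hi]) (hQ _ _ hx)
    rw [h2, ← nsmul_eq_mul]
    refine (Finset.abs_sum_le_sum_abs _ _).trans (Finset.sum_le_card_nsmul _ _ _ fun x _ => ?_)
    unfold pq
    rw [Finset.abs_prod]
    refine (Finset.prod_le_prod (fun _ _ => abs_nonneg _) (fun _ _ => hB _ _)).trans ?_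
    rw [Finset.prod_const, card_firsts p hp]
  rw [norm_mul, Real.norm_eq_abs, Real.norm_eq_abs, abs_of_pos (by positivity)]
  have h3 : (A.card : ℝ) ≤ N * ((2 * n + 1) ^ 2) ^ m * (3 * N) ^ (m - 1) := by
    have h4 : (A.card : ℝ) ≤ N * ((2 * n + 1) ^ 2) ^ m * (2 * N + 1) ^ (m - 1) := by exact_mod_cast hcount
    refine h4.trans ?_
    gcongr
    linarith
  calc _ ≤ ((N:ℝ)^(m+1))⁻¹ * ((N * ((2 * n + 1) ^ 2) ^ m * (3 * N) ^ (m - 1)) * B ^ m) := by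
        gcongr
        exact h1.trans (by gcongr)
    _ = K * (N:ℝ)⁻¹ := by
        obtain ⟨r, rfl⟩ : ∃ r, m = r + 1 := ⟨m - 1, by omega⟩
        rw [hK, mul_pow]
        simp only [Nat.add_sub_cancel]
        field_simp
        ring

/-- the limiting product -/
def TT {m : ℕ} (Q : ℤ → ℤ → ℝ) (p : Equiv.Perm (Fin (2 * m))) (k : Fin (2 * m) → ℤ) : ℝ :=
  ∏ i ∈ Finset.univ.filter (fun i => i < p i), Q (- k (p i)) (k i)

lemma TT_zero {m : ℕ} (Q : ℤ → ℤ → ℝ) (n : ℕ)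
    (hQ : ∀ u v, ¬ (u, v) ∈ Finset.Icc (-(n:ℤ)) n ×ˢ Finset.Icc (-(n:ℤ)) n → Q u v = 0)
    (p : Equiv.Perm (Fin (2 * m))) (hp : p ∈ PP m) (k : Fin (2 * m) → ℤ)
    (hk : k ∉ Fintype.piFinset (fun _ : Fin (2 * m) => Finset.Icc (-(n:ℤ)) n)) : TT Q p k = 0 := by
  obtain ⟨hp1, hp2⟩ := (Finset.mem_filter.1 hp).2
  simp only [Fintype.mem_piFinset, not_forall] at hk
  obtain ⟨i, hi⟩ := hk
  rcases lt_or_gt_of_ne (hp2 i) with h | h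
  · refine Finset.prod_eq_zero (i := p i) (by simp [hp1, h]) (hQ _ _ fun h => hi ?_)
    rw [hp1] at h
    simp only [Finset.mem_product, Finset.mem_Icc] at h ⊢
    omega
  · refine Finset.prod_eq_zero (i := i) (by simp [h]) (hQ _ _ fun h => hi ?_)
    simp only [Finset.mem_product, Finset.mem_Icc] at h ⊢
    omega

open Classical in
lemma good_sum {m : ℕ} (Q : ℤ → ℤ → ℝ) (n : ℕ)
    (hQ : ∀ u v, ¬ (u, v) ∈ Finset.Icc (-(n:ℤ)) n ×ˢ Finset.Icc (-(n:ℤ)) n → Q u v = 0)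
    (p : Equiv.Perm (Fin (2 * m))) (hp : p ∈ PP m) (N : ℕ) :
    ∑ x : Fin (2*m) → Fin N, pq Q p ∅ (fun j => ((x j:ℕ):ℤ)) =
      ∑ k ∈ Fintype.piFinset (fun _ : Fin (2 * m) => Finset.Icc (-(n:ℤ)) n),
        TT Q p k * cnt (krewPerm m p) k N := by
  obtain ⟨hp1, hp2⟩ := (Finset.mem_filter.1 hp).2
  let κ : (Fin (2*m) → Fin N) → Fin (2 * m) → ℤ := fun x v =>
    ((x (p v) : ℕ) : ℤ) - ((x (finRotate _ v) : ℕ) : ℤ)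
  have h1 : ∀ x : Fin (2*m) → Fin N, pq Q p ∅ (fun j => ((x j:ℕ):ℤ)) =
      ∑ k ∈ Fintype.piFinset (fun _ : Fin (2 * m) => Finset.Icc (-(n:ℤ)) n),
        if κ x = k then TT Q p k else 0 := by
    intro x
    have h2 : pq Q p ∅ (fun j => ((x j:ℕ):ℤ)) = TT Q p (κ x) := by
      unfold pq TT
      refine Finset.prod_congr rfl fun i _ => ?_
      simp [offs, κ, hp1]
    rw [Finset.sum_ite_eq, h2]
    split_ifs with h
    · rfl
    · exact TT_zero Q n hQ p hp _ h
  simp_rw [h1]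
  rw [Finset.sum_comm]
  refine Finset.sum_congr rfl fun k _ => ?_
  rw [← Finset.sum_filter, Finset.sum_const, nsmul_eq_mul, mul_comm]
  congr 2
  unfold cnt
  refine Finset.card_bij' (fun x _ j => x (finRotate _ j)) (fun y _ j => y ((finRotate _).symm j)) ?_ ?_ ?_ ?_
  · intro x hx
    simp only [Finset.mem_filter, Finset.mem_univ, true_and] at hx ⊢
    intro j
    rw [← hx]
    simp only [κ, krewPerm, Equiv.trans_apply, hp1]
  · intro y hy
    simp only [Finset.mem_filter, Finset.mem_univ, true_and] at hy ⊢
    funext v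
    have := hy ((finRotate _).symm (p v))
    simp only [krewPerm, Equiv.trans_apply, Equiv.apply_symm_apply, hp1] at this
    rw [← this]
    simp only [κ, Equiv.symm_apply_apply]
  · intro x _; funext j; simp only [Equiv.apply_symm_apply]
  · intro x _; funext j; simp only [Equiv.symm_apply_apply]

open Classical in
lemma good_lim {m : ℕ} (hm : 1 ≤ m) (Q : ℤ → ℤ → ℝ) (n : ℕ)
    (hQ : ∀ u v, ¬ (u, v) ∈ Finset.Icc (-(n:ℤ)) n ×ˢ Finset.Icc (-(n:ℤ)) n → Q u v = 0)
    (p : Equiv.Perm (Fin (2 * m))) (hp : p ∈ PP m) (hp' : p ∈ NCPairings m) :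
    Tendsto (fun N : ℕ => ((N:ℝ)^(m+1))⁻¹ * ∑ x : Fin (2*m) → Fin N, pq Q p ∅ (fun j => ((x j:ℕ):ℤ)))
      atTop (nhds (∑ k ∈ Fintype.piFinset (fun _ : Fin (2 * m) => Finset.Icc (-(n:ℤ)) n),
        if memS m p k then TT Q p k else 0)) := by
  simp_rw [good_sum Q n hQ p hp, Finset.mul_sum]
  refine tendsto_finsetSum _ fun k _ => ?_
  split_ifs with h
  · have := (cnt_lim (krewPerm m p) k h).const_mul (TT Q p k)
    rw [nc_krew (by omega) p hp'] at this
    rw [mul_one] at this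
    refine this.congr fun N => by ring
  · have := cnt_zero (krewPerm m p) k h
    simp [this]

open Classical in
/-- limit of mean moments -/
noncomputable def MM (Q : ℤ → ℤ → ℝ) (n m : ℕ) : ℝ :=
  ∑ p ∈ NCPairings m, ∑ k ∈ Fintype.piFinset (fun _ : Fin (2 * m) => Finset.Icc (-(n:ℤ)) n),
        if memS m p k then TT Q p k else 0

lemma mean_lim {m : ℕ} (hm : 1 ≤ m) (Q : ℤ → ℤ → ℝ) (n : ℕ) (B : ℝ)
    (hQ : ∀ u v, ¬ (u, v) ∈ Finset.Icc (-(n:ℤ)) n ×ˢ Finset.Icc (-(n:ℤ)) n → Q u v = 0)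
    (hB : ∀ u v, |Q u v| ≤ B) :
    Tendsto (fun N : ℕ => ∑ p ∈ PP m, ((N:ℝ)^(m+1))⁻¹ * ∑ x : Fin (2*m) → Fin N, tm Q p (fun j => ((x j:ℕ):ℤ)))
      atTop (nhds (MM Q n m)) := by
  classical
  have hMM : MM Q n m = ∑ p ∈ PP m, if p ∈ NCPairings m then
      ∑ k ∈ Fintype.piFinset (fun _ : Fin (2 * m) => Finset.Icc (-(n:ℤ)) n),
        (if memS m p k then TT Q p k else 0) else 0 := by
    rw [← Finset.sum_filter, MM]
    refine Finset.sum_congr ?_ fun _ _ => rfl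
    ext p
    simp only [NCPairings, PP, Finset.mem_filter, Finset.mem_univ, true_and]
    tauto
  rw [hMM]
  refine tendsto_finsetSum _ fun p hp => ?_
  simp_rw [tm_expand]
  have hF : ∀ N : ℕ, ((N:ℝ)^(m+1))⁻¹ * ∑ x : Fin (2*m) → Fin N,
      ∑ H ∈ (Finset.univ.filter (fun i => i < p i)).powerset, pq Q p H (fun j => ((x j:ℕ):ℤ)) =
      ∑ H ∈ (Finset.univ.filter (fun i => i < p i)).powerset, ((N:ℝ)^(m+1))⁻¹ * ∑ x : Fin (2*m) → Fin N,
       pq Q p H (fun j => ((x j:ℕ):ℤ)) := by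
    intro N
    rw [Finset.sum_comm, Finset.mul_sum]
  simp_rw [hF]
  have hG : (if p ∈ NCPairings m then
      ∑ k ∈ Fintype.piFinset (fun _ : Fin (2 * m) => Finset.Icc (-(n:ℤ)) n),
        (if memS m p k then TT Q p k else 0) else 0) =
      ∑ H ∈ (Finset.univ.filter (fun i => i < p i)).powerset, if H = ∅ then (if p ∈ NCPairings m then
      ∑ k ∈ Fintype.piFinset (fun _ : Fin (2 * m) => Finset.Icc (-(n:ℤ)) n),
        (if memS m p k then TT Q p k else 0) else 0) else 0 := by
    rw [Finset.sum_ite_eq']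
    simp
  rw [hG]
  refine tendsto_finsetSum _ fun H hH => ?_
  by_cases hH0 : H = ∅
  · rw [if_pos hH0]
    by_cases hNC : p ∈ NCPairings m
    · rw [if_pos hNC, hH0]
      exact good_lim hm Q n hQ p hp hNC
    · rw [if_neg hNC]
      have h1 := (Finset.mem_filter.1 hp).2
      have h2 : ∃ a b, a < b ∧ b < p a ∧ p a < p b := by
        by_contra hcon
        push Not at hcon
        apply hNC
        simp only [NCPairings, Finset.mem_filter, Finset.mem_univ, true_and]
        exact ⟨h1.1, h1.2, fun a b h => absurd h.2.2 (not_lt.2 (hcon a b h.1 h.2.1))⟩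
      obtain ⟨a, b, h3, h4, h5⟩ := h2
      exact bad_lim hm Q n B hQ hB p hp H a (h3.trans h4) (Or.inr ⟨hH0, b, h3, h4, h5⟩)
  · rw [if_neg hH0]
    obtain ⟨a, ha⟩ := Finset.nonempty_iff_ne_empty.2 hH0
    exact bad_lim hm Q n B hQ hB p hp H a (Finset.mem_filter.1 (Finset.mem_powerset.1 hH ha)).2 (Or.inl ha)

lemma esd_mono {N : ℕ} {A : Matrix (Fin N) (Fin N) ℝ} {g h : ℝ → ℝ} (hgh : ∀ x, g x ≤ h x) :
    esdEval A g ≤ esdEval A h := by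
  unfold esdEval
  split_ifs
  · gcongr; exact hgh _
  · exact le_rfl

lemma esd_add {N : ℕ} {A : Matrix (Fin N) (Fin N) ℝ} (g h : ℝ → ℝ) (c : ℝ) :
    esdEval A (fun x => g x + c * h x) = esdEval A g + c * esdEval A h := by
  unfold esdEval
  split_ifs
  · rw [Finset.sum_add_distrib, ← Finset.mul_sum]; ring
  · simp

lemma esd_const {N : ℕ} {A : Matrix (Fin N) (Fin N) ℝ} (c : ℝ) (hc : 0 ≤ c) :
    esdEval A (fun _ => c) ≤ c := by
  unfold esdEval
  split_ifs
  · simp only [Finset.sum_const, Finset.card_univ, Fintype.card_fin, nsmul_eq_mul]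
    rcases Nat.eq_zero_or_pos N with h | h
    · subst h; simpa using hc
    · have : (0:ℝ) < N := by exact_mod_cast h
      rw [← mul_assoc, inv_mul_cancel₀ this.ne', one_mul]
  · exact hc

lemma esd_nonneg {N : ℕ} {A : Matrix (Fin N) (Fin N) ℝ} {g : ℝ → ℝ} (hg : ∀ x, 0 ≤ g x) :
    0 ≤ esdEval A g := by
  unfold esdEval
  split_ifs
  · exact mul_nonneg (by positivity) (Finset.sum_nonneg fun _ _ => hg _)
  · exact le_rfl

section
variable {Ω : Type} [MeasurableSpace Ω] {P : Measure Ω} [IsProbabilityMeasure P]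

lemma trunc_bounds (A : (N : ℕ) → Ω → Matrix (Fin N) (Fin N) ℝ) (μ : Measure ℝ) [IsProbabilityMeasure μ]
    (hconv : ESDTendstoInProb P A μ)
    (M : ℕ → ℝ)
    (hint : ∀ m, 1 ≤ m → ∀ N, Integrable (fun ω => esdEval (A N ω) (fun x => x ^ (2 * m))) P)
    (hlim : ∀ m, 1 ≤ m → Tendsto (fun N => ∫ ω, esdEval (A N ω) (fun x => x ^ (2 * m)) ∂P) atTop (nhds (M m)))
    (m : ℕ) (hm : 1 ≤ m) (K : ℝ) (hK : 0 < K) :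
    ∫ x, min (x ^ (2 * m)) K ∂μ ≤ M m ∧ M m - M (2 * m) * K⁻¹ ≤ ∫ x, min (x ^ (2 * m)) K ∂μ := by
  set g : ℝ → ℝ := fun x => min (x ^ (2 * m)) K with hg
  have hg0 : ∀ x, 0 ≤ g x := fun x => le_min (Even.pow_nonneg (by simp) x) hK.le
  have hgK : ∀ x, g x ≤ K := fun x => min_le_right _ _
  have hgx : ∀ x, g x ≤ x ^ (2 * m) := fun x => min_le_left _ _
  have hgc : Continuous g := by fun_prop
  set I := ∫ x, g x ∂μ with hI
  have hI0 : 0 ≤ I := integral_nonneg hg0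
  have hx0 : ∀ (x : ℝ) (r : ℕ), 0 ≤ x ^ (2 * r) := fun x r => Even.pow_nonneg (by simp) x
  have hupper : ∀ x, x ^ (2 * m) ≤ g x + K⁻¹ * x ^ (2 * (2 * m)) := by
    intro x
    simp only [hg]
    rcases le_total (x ^ (2 * m)) K with h | h
    · rw [min_eq_left h]
      have := mul_nonneg (inv_nonneg.2 hK.le) (hx0 x (2 * m))
      linarith
    · rw [min_eq_right h]
      have h1 : x ^ (2 * (2 * m)) = x ^ (2 * m) * x ^ (2 * m) := by ring
      rw [h1]
      have h2 : x ^ (2 * m) ≤ K⁻¹ * (x ^ (2 * m) * x ^ (2 * m)) := by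
        rw [le_inv_mul_iff₀ hK]
        exact mul_le_mul_of_nonneg_right h (hx0 x m)
      linarith
  have key : ∀ ε > 0, I - ε ≤ M m ∧ M m ≤ I + ε + K⁻¹ * M (2 * m) := by
    intro ε hε
    let B : ℕ → Set Ω := fun N => toMeasurable P {ω | ε ≤ |esdEval (A N ω) g - I|}
    have hBm : ∀ N, MeasurableSet (B N) := fun N => measurableSet_toMeasurable _ _
    have hBP : Tendsto (fun N => P.real (B N)) atTop (nhds 0) := by
      have h1 := hconv g hgc ⟨K, fun x => by rw [abs_of_nonneg (hg0 x)]; exact hgK x⟩ ε hε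
      have h2 : (fun N => P.real (B N)) = fun N => (P {ω | ε ≤ |esdEval (A N ω) g - I|}).toReal := by
        funext N
        simp only [B, Measure.real, measure_toMeasurable]
      rw [h2]
      have := (ENNReal.tendsto_toReal ENNReal.zero_ne_top).comp h1
      rw [ENNReal.toReal_zero] at this
      exact this
    have hBc : ∀ N ω, ω ∉ B N → |esdEval (A N ω) g - I| < ε := by
      intro N ω h
      by_contra hcon
      exact h (subset_toMeasurable _ _ (not_lt.1 hcon))
    have hind : ∀ N (c : ℝ), Integrable (fun ω => (B N).indicator (fun _ => c) ω) P := fun N c =>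
      (integrable_const c).indicator (hBm N)
    have hindI : ∀ N (c : ℝ), ∫ ω, (B N).indicator (fun _ => c) ω ∂P = P.real (B N) * c := fun N c => by
      rw [integral_indicator (hBm N), setIntegral_const, smul_eq_mul]
    constructor
    · have h1 : ∀ N, I - ε - P.real (B N) * I ≤ ∫ ω, esdEval (A N ω) (fun x => x ^ (2 * m)) ∂P := by
        intro N
        have h2 : I - ε - P.real (B N) * I = ∫ ω, ((I - ε) - (B N).indicator (fun _ => I) ω) ∂P := by
          rw [integral_sub (integrable_const _) (hind N I), hindI]; simp
        rw [h2]
        refine integral_mono ((integrable_const _).sub (hind N I)) (hint m hm N) fun ω => ?_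
        by_cases hω : ω ∈ B N
        · simp only [Set.indicator_of_mem hω]
          have := esd_nonneg (A := A N ω) (g := fun x => x ^ (2 * m)) (fun x => hx0 x m)
          linarith
        · simp only [Set.indicator_of_notMem hω]
          have h3 := abs_lt.1 (hBc N ω hω)
          have h4 := esd_mono (A := A N ω) hgx
          linarith
      have h5 : Tendsto (fun N => I - ε - P.real (B N) * I) atTop (nhds (I - ε)) := by
        simpa using (hBP.mul_const I).const_sub (I - ε)
      exact le_of_tendsto_of_tendsto' h5 (hlim m hm) h1
    · have h1 : ∀ N, ∫ ω, esdEval (A N ω) (fun x => x ^ (2 * m)) ∂P ≤ I + ε + P.real (B N) * K +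
          K⁻¹ * ∫ ω, esdEval (A N ω) (fun x => x ^ (2 * (2 * m))) ∂P := by
        intro N
        have h2 : I + ε + P.real (B N) * K +
          K⁻¹ * ∫ ω, esdEval (A N ω) (fun x => x ^ (2 * (2 * m))) ∂P =
          ∫ ω, (((I + ε) + (B N).indicator (fun _ => K) ω) + K⁻¹ * esdEval (A N ω) (fun x => x ^ (2 * (2 * m)))) ∂P := by
          have hh : Integrable (fun ω => (I + ε) + (B N).indicator (fun _ => K) ω) P :=
            (integrable_const _).add (hind N K)
          rw [integral_add hh ((hint (2 * m) (by omega) N).const_mul _),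
            integral_add (integrable_const _) (hind N K), hindI, integral_const_mul]; simp
        rw [h2]
        refine integral_mono (hint m hm N) (((integrable_const _).add (hind N K)).add
          ((hint (2 * m) (by omega) N).const_mul _)) fun ω => ?_
        have h3 := esd_mono (A := A N ω) hupper
        rw [esd_add] at h3
        by_cases hω : ω ∈ B N
        · simp only [Set.indicator_of_mem hω]
          have h4 := (esd_mono (A := A N ω) hgK).trans (esd_const K hK.le)
          linarith
        · simp only [Set.indicator_of_notMem hω]
          have h5 := abs_lt.1 (hBc N ω hω)
          linarith
      have h5 : Tendsto (fun N => I + ε + P.real (B N) * K +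
          K⁻¹ * ∫ ω, esdEval (A N ω) (fun x => x ^ (2 * (2 * m))) ∂P) atTop (nhds (I + ε + K⁻¹ * M (2 * m))) := by
        simpa using ((hBP.mul_const K).const_add (I + ε)).add ((hlim (2 * m) (by omega)).const_mul K⁻¹)
      exact le_of_tendsto_of_tendsto' (hlim m hm) h5 h1
  constructor
  · exact le_of_forall_pos_le_add fun ε hε => by linarith [(key ε hε).1]
  · exact le_of_forall_pos_le_add fun ε hε => by linarith [(key ε hε).2]

lemma moment_eq (A : (N : ℕ) → Ω → Matrix (Fin N) (Fin N) ℝ) (μ : Measure ℝ) [IsProbabilityMeasure μ]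
    (hconv : ESDTendstoInProb P A μ)
    (M : ℕ → ℝ)
    (hint : ∀ m, 1 ≤ m → ∀ N, Integrable (fun ω => esdEval (A N ω) (fun x => x ^ (2 * m))) P)
    (hlim : ∀ m, 1 ≤ m → Tendsto (fun N => ∫ ω, esdEval (A N ω) (fun x => x ^ (2 * m)) ∂P) atTop (nhds (M m)))
    (m : ℕ) (hm : 1 ≤ m) : ∫ x, x ^ (2 * m) ∂μ = M m := by
  have hb := trunc_bounds A μ hconv M hint hlim m hm
  have hx0 : ∀ (x : ℝ), 0 ≤ x ^ (2 * m) := fun x => Even.pow_nonneg (by simp) x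
  have hg0 : ∀ (K : ℕ) (x : ℝ), 0 ≤ min (x ^ (2 * m)) (K + 1 : ℝ) := fun K x => le_min (hx0 x) (by positivity)
  have hM0 : 0 ≤ M m := (integral_nonneg (hg0 0)).trans (hb ((0:ℕ) + 1) (by positivity)).1
  have hI : Tendsto (fun K : ℕ => ∫ x, min (x ^ (2 * m)) (K + 1 : ℝ) ∂μ) atTop (nhds (M m)) := by
    have h1 : Tendsto (fun K : ℕ => M m - M (2 * m) * (K + 1 : ℝ)⁻¹) atTop (nhds (M m)) := by
      have : Tendsto (fun K : ℕ => (K + 1 : ℝ)⁻¹) atTop (nhds 0) := by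
        simpa using tendsto_one_div_add_atTop_nhds_zero_nat (𝕜 := ℝ)
      simpa using (this.const_mul (M (2 * m))).const_sub (M m)
    exact tendsto_of_tendsto_of_tendsto_of_le_of_le h1 tendsto_const_nhds
      (fun K => (hb (K + 1) (by positivity)).2) (fun K => (hb (K + 1) (by positivity)).1)
  have hL : Tendsto (fun K : ℕ => ∫⁻ x, ENNReal.ofReal (min (x ^ (2 * m)) (K + 1 : ℝ)) ∂μ) atTop
      (nhds (∫⁻ x, ENNReal.ofReal (x ^ (2 * m)) ∂μ)) := by
    refine lintegral_tendsto_of_tendsto_of_monotone (fun K => by fun_prop) ?_ ?_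
    · refine Eventually.of_forall fun x K L hKL => ?_
      refine ENNReal.ofReal_le_ofReal (min_le_min_left _ ?_)
      have : (K : ℝ) ≤ L := by exact_mod_cast hKL
      linarith
    · refine Eventually.of_forall fun x => ?_
      refine tendsto_const_nhds.congr' ?_
      obtain ⟨K0, hK0⟩ := exists_nat_ge (x ^ (2 * m))
      filter_upwards [eventually_ge_atTop K0] with K hK
      rw [min_eq_left]
      have : (K0 : ℝ) ≤ K := by exact_mod_cast hK
      linarith
  have hL2 : (fun K : ℕ => ∫⁻ x, ENNReal.ofReal (min (x ^ (2 * m)) (K + 1 : ℝ)) ∂μ) =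
      fun K : ℕ => ENNReal.ofReal (∫ x, min (x ^ (2 * m)) (K + 1 : ℝ) ∂μ) := by
    funext K
    rw [ofReal_integral_eq_lintegral_ofReal]
    · refine Integrable.of_bound (C := K + 1) (by fun_prop) (Eventually.of_forall fun x => ?_)
      rw [Real.norm_eq_abs, abs_of_nonneg (hg0 K x)]
      exact min_le_right _ _
    · exact Eventually.of_forall (hg0 K)
  rw [hL2] at hL
  have h3 := tendsto_nhds_unique hL (ENNReal.tendsto_ofReal hI)
  rw [integral_eq_lintegral_of_nonneg_ae (Eventually.of_forall hx0) (by fun_prop), h3, ENNReal.toReal_ofReal hM0]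
end

lemma orth (k : ℤ) : ∫ x in Set.Ioc (-π) π, Complex.exp (Complex.I * ((k * x : ℝ) : ℂ)) =
    if k = 0 then (2 * π : ℂ) else 0 := by
  rw [← intervalIntegral.integral_of_le (by linarith [Real.pi_pos])]
  split_ifs with h
  · subst h
    simp
    ring
  · have hc : Complex.I * (k : ℂ) ≠ 0 := mul_ne_zero Complex.I_ne_zero (by exact_mod_cast h)
    have h1 : ∀ x : ℝ, Complex.exp (Complex.I * ((k * x : ℝ) : ℂ)) = Complex.exp (Complex.I * (k : ℂ) * x) := by
      intro x; congr 1; push_cast; ring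
    simp_rw [h1]
    rw [integral_exp_mul_complex hc]
    have h2 : Complex.exp (Complex.I * (k : ℂ) * (π : ℝ)) = Complex.exp (Complex.I * (k : ℂ) * ((-π : ℝ) : ℂ)) := by
      rw [← Complex.exp_periodic.int_mul k (Complex.I * (k : ℂ) * ((-π : ℝ) : ℂ))]
      congr 1; push_cast; ring
    rw [h2, sub_self, zero_div]

lemma specBox_fin : volume specBox < ⊤ := by
  unfold specBox
  rw [Measure.volume_eq_prod, Measure.prod_prod]
  simp [ENNReal.mul_lt_top]

lemma F1 (n : ℕ) (c : ℤ → ℤ → ℂ) (u v : ℤ) :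
    ∫ q in specBox, Complex.exp (Complex.I * ((u * q.1 + v * q.2 : ℝ) : ℂ)) *
      (∑ j ∈ Finset.Icc (-(n : ℤ)) n, ∑ k ∈ Finset.Icc (-(n : ℤ)) n,
        c j k * Complex.exp (Complex.I * ((j * q.1 + k * q.2 : ℝ) : ℂ))) =
    if (u, v) ∈ Finset.Icc (-(n:ℤ)) n ×ˢ Finset.Icc (-(n:ℤ)) n then (2 * π : ℂ) ^ 2 * c (-u) (-v) else 0 := by
  have h1 : ∀ q : ℝ × ℝ, Complex.exp (Complex.I * ((u * q.1 + v * q.2 : ℝ) : ℂ)) *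
      (∑ j ∈ Finset.Icc (-(n : ℤ)) n, ∑ k ∈ Finset.Icc (-(n : ℤ)) n,
        c j k * Complex.exp (Complex.I * ((j * q.1 + k * q.2 : ℝ) : ℂ))) =
      ∑ j ∈ Finset.Icc (-(n : ℤ)) n, ∑ k ∈ Finset.Icc (-(n : ℤ)) n,
        c j k * (Complex.exp (Complex.I * (((u + j : ℤ) * q.1 : ℝ) : ℂ)) *
          Complex.exp (Complex.I * (((v + k : ℤ) * q.2 : ℝ) : ℂ))) := by
    intro q
    rw [Finset.mul_sum]
    refine Finset.sum_congr rfl fun j _ => ?_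
    rw [Finset.mul_sum]
    refine Finset.sum_congr rfl fun k _ => ?_
    rw [mul_left_comm, ← Complex.exp_add, ← Complex.exp_add]
    congr 2
    push_cast; ring
  simp_rw [h1]
  have hint : ∀ j k, Integrable (fun q : ℝ × ℝ => c j k * (Complex.exp (Complex.I * (((u + j : ℤ) * q.1 : ℝ) : ℂ)) *
          Complex.exp (Complex.I * (((v + k : ℤ) * q.2 : ℝ) : ℂ)))) (volume.restrict specBox) := by
    intro j k
    have : IsFiniteMeasure (volume.restrict specBox) := ⟨by simpa using specBox_fin⟩
    refine Integrable.of_bound (C := ‖c j k‖) (Continuous.aestronglyMeasurable (by fun_prop)) (Eventually.of_forall fun q => ?_)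
    rw [norm_mul, norm_mul, mul_comm Complex.I, Complex.norm_exp_ofReal_mul_I, mul_comm Complex.I,
      Complex.norm_exp_ofReal_mul_I]
    simp
  rw [integral_finsetSum _ (fun j _ => integrable_finsetSum _ (fun k _ => hint j k))]
  simp_rw [integral_finsetSum _ (fun k _ => hint _ k), integral_const_mul]
  have h2 : ∀ j k : ℤ, ∫ q in specBox, (Complex.exp (Complex.I * (((u + j : ℤ) * q.1 : ℝ) : ℂ)) *
          Complex.exp (Complex.I * (((v + k : ℤ) * q.2 : ℝ) : ℂ))) =
      (if u + j = 0 then (2 * π : ℂ) else 0) * (if v + k = 0 then (2 * π : ℂ) else 0) := by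
    intro j k
    unfold specBox
    rw [Measure.volume_eq_prod, setIntegral_prod_mul
      (fun x : ℝ => Complex.exp (Complex.I * (((u + j : ℤ) * x : ℝ) : ℂ)))
      (fun x : ℝ => Complex.exp (Complex.I * (((v + k : ℤ) * x : ℝ) : ℂ))), orth, orth]
  simp_rw [h2]
  split_ifs with h
  · simp only [Finset.mem_product, Finset.mem_Icc] at h
    rw [Finset.sum_eq_single (-u), Finset.sum_eq_single (-v)]
    · simp; ring
    · intro k _ hk
      rw [if_neg (show ¬ v + k = 0 by omega)]; simp
    · intro hk; exact absurd (Finset.mem_Icc.2 (by omega)) hk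
    · intro j _ hj
      rw [if_neg (show ¬ u + j = 0 by omega)]; simp
    · intro hk; exact absurd (Finset.mem_Icc.2 (by omega)) hk
  · refine Finset.sum_eq_zero fun j hj => Finset.sum_eq_zero fun k hk => ?_
    simp only [Finset.mem_product, Finset.mem_Icc] at h hj hk
    by_cases hu : u + j = 0
    · rw [if_neg (show ¬ v + k = 0 by omega)]; simp
    · rw [if_neg hu]; simp

section
set_option linter.unusedSectionVars false
variable {Ω : Type} [MeasurableSpace Ω] {P : Measure Ω}

lemma rr_eq {X : ℤ → ℤ → Ω → ℝ} {f : ℝ × ℝ → ℝ} {n : ℕ} {a : ℤ → ℤ → ℝ}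
    (hf : ∀ q : ℝ × ℝ, ((f q : ℝ) : ℂ) =
      ∑ j ∈ Finset.Icc (-(n : ℤ)) n, ∑ k ∈ Finset.Icc (-(n : ℤ)) n,
        ((a j k : ℝ) : ℂ) * Complex.exp (Complex.I * ((j * q.1 + k * q.2 : ℝ) : ℂ)))
    (hXf : HasSpecDensity P X f) (u v : ℤ) :
    rr P X u v = if (u, v) ∈ Finset.Icc (-(n:ℤ)) n ×ˢ Finset.Icc (-(n:ℤ)) n then (2 * π) ^ 2 * a (-u) (-v) else 0 := by
  have h := hXf u v
  simp_rw [hf] at h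
  rw [F1 n (fun j k => ((a j k : ℝ) : ℂ))] at h
  have h2 : ((rr P X u v : ℝ) : ℂ) = ((if (u, v) ∈ Finset.Icc (-(n:ℤ)) n ×ˢ Finset.Icc (-(n:ℤ)) n then (2 * π) ^ 2 * a (-u) (-v) else 0 : ℝ) : ℂ) := by
    rw [rr, ← h]
    split_ifs <;> push_cast <;> rfl
  exact_mod_cast h2

lemma QQ_zero {X : ℤ → ℤ → Ω → ℝ} {f : ℝ × ℝ → ℝ} {n : ℕ} {a : ℤ → ℤ → ℝ}
    (hf : ∀ q : ℝ × ℝ, ((f q : ℝ) : ℂ) =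
      ∑ j ∈ Finset.Icc (-(n : ℤ)) n, ∑ k ∈ Finset.Icc (-(n : ℤ)) n,
        ((a j k : ℝ) : ℂ) * Complex.exp (Complex.I * ((j * q.1 + k * q.2 : ℝ) : ℂ)))
    (hXf : HasSpecDensity P X f) (u v : ℤ)
    (h : ¬ (u, v) ∈ Finset.Icc (-(n:ℤ)) n ×ˢ Finset.Icc (-(n:ℤ)) n) : QQ P X u v = 0 := by
  have h' : ¬ (v, u) ∈ Finset.Icc (-(n:ℤ)) n ×ˢ Finset.Icc (-(n:ℤ)) n := by
    simp only [Finset.mem_product] at h ⊢; tauto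
  rw [QQ, rr_eq hf hXf, rr_eq hf hXf, if_neg h, if_neg h', add_zero]

lemma QQ_symm (X : ℤ → ℤ → Ω → ℝ) (u v : ℤ) : QQ P X u v = QQ P X v u := by
  simp only [QQ]; ring

lemma Q_bdd (Q : ℤ → ℤ → ℝ) (n : ℕ)
    (hQ : ∀ u v, ¬ (u, v) ∈ Finset.Icc (-(n:ℤ)) n ×ˢ Finset.Icc (-(n:ℤ)) n → Q u v = 0) :
    ∃ B, ∀ u v, |Q u v| ≤ B := by
  refine ⟨∑ q ∈ Finset.Icc (-(n:ℤ)) n ×ˢ Finset.Icc (-(n:ℤ)) n, |Q q.1 q.2|, fun u v => ?_⟩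
  by_cases h : (u, v) ∈ Finset.Icc (-(n:ℤ)) n ×ˢ Finset.Icc (-(n:ℤ)) n
  · exact Finset.single_le_sum (f := fun q : ℤ × ℤ => |Q q.1 q.2|) (fun _ _ => abs_nonneg _) h
  · rw [hQ u v h, abs_zero]; exact Finset.sum_nonneg fun _ _ => abs_nonneg _

/-- Fourier expansion of the symmetrized density -/
lemma g_exp {f : ℝ × ℝ → ℝ} {n : ℕ} {a : ℤ → ℤ → ℝ}
    (hf : ∀ q : ℝ × ℝ, ((f q : ℝ) : ℂ) =
      ∑ j ∈ Finset.Icc (-(n : ℤ)) n, ∑ k ∈ Finset.Icc (-(n : ℤ)) n,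
        ((a j k : ℝ) : ℂ) * Complex.exp (Complex.I * ((j * q.1 + k * q.2 : ℝ) : ℂ))) (x y : ℝ) :
    ((f (x, -y) + f (-y, x) : ℝ) : ℂ) =
      ∑ j ∈ Finset.Icc (-(n : ℤ)) n, ∑ k ∈ Finset.Icc (-(n : ℤ)) n,
        ((a j (-k) + a (-k) j : ℝ) : ℂ) * Complex.exp (Complex.I * ((j * x + k * y : ℝ) : ℂ)) := by
  have hneg : ∀ F : ℤ → ℂ, ∑ k ∈ Finset.Icc (-(n : ℤ)) n, F (-k) = ∑ k ∈ Finset.Icc (-(n : ℤ)) n, F k := by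
    intro F
    refine Finset.sum_equiv (Equiv.neg ℤ) (fun k => ?_) (fun _ _ => rfl)
    simp only [Finset.mem_Icc, Equiv.neg_apply]; omega
  push_cast
  rw [hf, hf]
  simp_rw [add_mul, Finset.sum_add_distrib]
  congr 1
  · refine Finset.sum_congr rfl fun j _ => ?_
    rw [← hneg]
    refine Finset.sum_congr rfl fun k _ => ?_
    congr 3; push_cast; ring
  · rw [Finset.sum_comm]
    refine Finset.sum_congr rfl fun j _ => ?_
    rw [← hneg]
    refine Finset.sum_congr rfl fun k _ => ?_
    congr 3; push_cast; ring

lemma ghat {X : ℤ → ℤ → Ω → ℝ} {f : ℝ × ℝ → ℝ} {n : ℕ} {a : ℤ → ℤ → ℝ}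
    (hf : ∀ q : ℝ × ℝ, ((f q : ℝ) : ℂ) =
      ∑ j ∈ Finset.Icc (-(n : ℤ)) n, ∑ k ∈ Finset.Icc (-(n : ℤ)) n,
        ((a j k : ℝ) : ℂ) * Complex.exp (Complex.I * ((j * q.1 + k * q.2 : ℝ) : ℂ)))
    (hXf : HasSpecDensity P X f) (u v : ℤ) :
    ∫ q in specBox, Complex.exp (Complex.I * ((u * q.1 + v * q.2 : ℝ) : ℂ)) *
                  ((f (q.1, -q.2) + f (-q.2, q.1) : ℝ) : ℂ) = ((QQ P X (-v) u : ℝ) : ℂ) := by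
  simp_rw [g_exp hf]
  rw [F1 n (fun j k => ((a j (-k) + a (-k) j : ℝ) : ℂ)), QQ, rr_eq hf hXf, rr_eq hf hXf]
  have e1 : ((-v, u) ∈ Finset.Icc (-(n:ℤ)) n ×ˢ Finset.Icc (-(n:ℤ)) n) ↔ (u, v) ∈ Finset.Icc (-(n:ℤ)) n ×ˢ Finset.Icc (-(n:ℤ)) n := by
    simp only [Finset.mem_product, Finset.mem_Icc]; omega
  have e2 : ((u, -v) ∈ Finset.Icc (-(n:ℤ)) n ×ˢ Finset.Icc (-(n:ℤ)) n) ↔ (u, v) ∈ Finset.Icc (-(n:ℤ)) n ×ˢ Finset.Icc (-(n:ℤ)) n := by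
    simp only [Finset.mem_product, Finset.mem_Icc]; omega
  simp only [e1, e2]
  split_ifs
  · simp only [neg_neg]; push_cast; ring
  · simp

lemma g_exp2 {X : ℤ → ℤ → Ω → ℝ} {f : ℝ × ℝ → ℝ} {n : ℕ} {a : ℤ → ℤ → ℝ}
    (hf : ∀ q : ℝ × ℝ, ((f q : ℝ) : ℂ) =
      ∑ j ∈ Finset.Icc (-(n : ℤ)) n, ∑ k ∈ Finset.Icc (-(n : ℤ)) n,
        ((a j k : ℝ) : ℂ) * Complex.exp (Complex.I * ((j * q.1 + k * q.2 : ℝ) : ℂ)))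
    (hXf : HasSpecDensity P X f) (x y : ℝ) :
    ((f (x, -y) + f (-y, x) : ℝ) : ℂ) =
      ∑ j ∈ Finset.Icc (-(n : ℤ)) n, ∑ k ∈ Finset.Icc (-(n : ℤ)) n,
        ((2 * π : ℂ) ^ 2)⁻¹ * ((QQ P X (-k) j : ℝ) : ℂ) * Complex.exp (Complex.I * ((-(j * x + k * y) : ℝ) : ℂ)) := by
  rw [g_exp hf]
  have hneg : ∀ F : ℤ → ℂ, ∑ k ∈ Finset.Icc (-(n : ℤ)) n, F (-k) = ∑ k ∈ Finset.Icc (-(n : ℤ)) n, F k := by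
    intro F
    refine Finset.sum_equiv (Equiv.neg ℤ) (fun k => ?_) (fun _ _ => rfl)
    simp only [Finset.mem_Icc, Equiv.neg_apply]; omega
  rw [← hneg]
  refine Finset.sum_congr rfl fun j hj => ?_
  rw [← hneg]
  refine Finset.sum_congr rfl fun k hk => ?_
  rw [Finset.mem_Icc] at hj hk
  rw [QQ, rr_eq hf hXf, rr_eq hf hXf, if_pos (by simp only [Finset.mem_product, Finset.mem_Icc]; omega),
    if_pos (by simp only [Finset.mem_product, Finset.mem_Icc]; omega)]
  have hpi : (π : ℂ) ≠ 0 := by exact_mod_cast Real.pi_ne_zero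
  have e : Complex.exp (Complex.I * (((-j : ℤ) * x + (-k : ℤ) * y : ℝ) : ℂ)) =
     Complex.exp (Complex.I * ((-(j * x + k * y) : ℝ) : ℂ)) := by
    congr 2; push_cast; ring
  rw [e]
  congr 1
  push_cast
  field_simp
  ring_nf
end

lemma prod_sum_pairs {m : ℕ} (p : Equiv.Perm (Fin (2 * m))) (hp : p ∈ PP m) (s : Finset ℤ)
    (G : Fin (2 * m) → ℤ → ℤ → ℂ) :
    ∏ i ∈ Finset.univ.filter (fun i => i < p i), ∑ j ∈ s, ∑ k ∈ s, G i j k =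
      ∑ κ ∈ Fintype.piFinset (fun _ : Fin (2 * m) => s),
        ∏ i ∈ Finset.univ.filter (fun i => i < p i), G i (κ i) (κ (p i)) := by
  classical
  obtain ⟨hp1, hp2⟩ := (Finset.mem_filter.1 hp).2
  set F := Finset.univ.filter (fun i => i < p i) with hF
  have memF : ∀ j, j ∈ F ↔ j < p j := fun j => by simp [F]
  simp_rw [← Finset.sum_product' s s]
  rw [← Finset.prod_coe_sort, Finset.prod_univ_sum]
  refine Finset.sum_bij' (fun (w : F → ℤ × ℤ) _ j => if h : j ∈ F then (w ⟨j, h⟩).1 else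
      if h : p j ∈ F then (w ⟨p j, h⟩).2 else 0)
    (fun (κ : Fin (2 * m) → ℤ) _ (i : F) => (κ i.1, κ (p i.1))) ?_ ?_ ?_ ?_ ?_
  · intro w hw
    simp only [Fintype.mem_piFinset, Finset.mem_product] at hw ⊢
    intro j
    by_cases h : j ∈ F
    · rw [dif_pos h]; exact (hw _).1
    · have h' : p j ∈ F := by
        rw [memF] at h ⊢; rw [hp1]
        exact lt_of_le_of_ne (not_lt.1 h) (hp2 j)
      rw [dif_neg h, dif_pos h']; exact (hw _).2
  · intro κ hκ
    simp only [Fintype.mem_piFinset, Finset.mem_product] at hκ ⊢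
    exact fun i => ⟨hκ _, hκ _⟩
  · intro w hw
    funext i
    have h1 : p i.1 ∉ F := by
      have := (memF i.1).1 i.2
      rw [memF, hp1]; exact this.le.not_gt
    have h2 : p (p i.1) ∈ F := by rw [hp1]; exact i.2
    ext
    · simp
    · simp only [dif_neg h1, dif_pos h2]
      congr 2
      exact Subtype.ext (hp1 _)
  · intro κ hκ
    funext j
    by_cases h : j ∈ F
    · simp only [dif_pos h]
    · have h' : p j ∈ F := by
        rw [memF] at h ⊢; rw [hp1]
        exact lt_of_le_of_ne (not_lt.1 h) (hp2 j)
      simp only [dif_neg h, dif_pos h', hp1]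
  · intro w hw
    rw [← Finset.prod_coe_sort F]
    refine Finset.prod_congr rfl fun i _ => ?_
    have h1 : p i.1 ∉ F := by
      have := (memF i.1).1 i.2
      rw [memF, hp1]; exact this.le.not_gt
    have h2 : p (p i.1) ∈ F := by rw [hp1]; exact i.2
    simp only [dif_neg h1, dif_pos h2, i.2, dif_pos]
    have h3 : (⟨p (p i.1), h2⟩ : F) = i := Subtype.ext (hp1 _)
    rw [h3]

lemma cube_exp {m : ℕ} (c : Fin (m + 1) → ℤ) :
    ∫ x in Set.univ.pi (fun _ : Fin (m + 1) => Set.Icc (-π) π), 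
      ∏ s, Complex.exp (Complex.I * ((c s * x s : ℝ) : ℂ)) = if ∀ s, c s = 0 then (2 * π : ℂ) ^ (m + 1) else 0 := by
  rw [volume_pi, Measure.restrict_pi_pi,
    integral_fintype_prod_eq_prod (𝕜 := ℂ) (fun (s : Fin (m + 1)) (t : ℝ) => Complex.exp (Complex.I * ((c s * t : ℝ) : ℂ)))]
  simp_rw [integral_Icc_eq_integral_Ioc, orth]
  split_ifs with h
  · simp [h]
  · push Not at h
    obtain ⟨s, hs⟩ := h
    exact Finset.prod_eq_zero (Finset.mem_univ s) (if_neg hs)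

lemma cube_exp' {m : ℕ} (k : Fin (2 * m) → ℤ) (T : Fin (2 * m) → Fin (m + 1)) :
    ∫ x in Set.univ.pi (fun _ : Fin (m + 1) => Set.Icc (-π) π), 
      Complex.exp (Complex.I * ((-∑ j, k j * x (T j) : ℝ) : ℂ)) =
      if ∀ s, ∑ j ∈ Finset.univ.filter (fun j => T j = s), k j = 0 then (2 * π : ℂ) ^ (m + 1) else 0 := by
  have h := cube_exp (fun s => - ∑ j ∈ Finset.univ.filter (fun j => T j = s), k j)
  simp only [neg_eq_zero] at h
  rw [← h]
  congr 1
  funext x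
  rw [← Complex.exp_sum, ← Finset.mul_sum, ← Complex.ofReal_sum]
  congr 3
  rw [← Finset.sum_fiberwise Finset.univ T, ← Finset.sum_neg_distrib]
  refine Finset.sum_congr rfl fun s _ => ?_
  push_cast
  rw [neg_mul, Finset.sum_mul]
  congr 1
  refine Finset.sum_congr rfl fun j hj => ?_
  rw [(Finset.mem_filter.1 hj).2]

lemma memS_iff {m : ℕ} (p : Equiv.Perm (Fin (2 * m))) (T : Fin (2 * m) → Fin (m + 1))
    (hT : IsKrewerasIndex m p T) (k : Fin (2 * m) → ℤ) :
    (∀ s, ∑ j ∈ Finset.univ.filter (fun j => T j = s), k j = 0) ↔ memS m p k := by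
  classical
  have hset : ∀ i, (Finset.univ.filter fun j => T j = T i) =
      Finset.univ.filter fun j => (krewPerm m p).SameCycle i j := by
    intro i
    ext j
    simp only [Finset.mem_filter, Finset.mem_univ, true_and]
    rw [eq_comm, hT.2.1]
  constructor
  · intro h i
    have := h (T i)
    rw [hset i] at this
    convert this
  · intro h s
    obtain ⟨i, rfl⟩ := hT.1 s
    have := h i
    rw [hset i]
    convert this

section
variable {Ω : Type} [MeasurableSpace Ω] {P : Measure Ω}

open Classical in
lemma int_L {X : ℤ → ℤ → Ω → ℝ} {f : ℝ × ℝ → ℝ} {n : ℕ} {a : ℤ → ℤ → ℝ}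
    (hf : ∀ q : ℝ × ℝ, ((f q : ℝ) : ℂ) =
      ∑ j ∈ Finset.Icc (-(n : ℤ)) n, ∑ k ∈ Finset.Icc (-(n : ℤ)) n,
        ((a j k : ℝ) : ℂ) * Complex.exp (Complex.I * ((j * q.1 + k * q.2 : ℝ) : ℂ)))
    (hXf : HasSpecDensity P X f) {m : ℕ} (hm : 1 ≤ m)
    (p : Equiv.Perm (Fin (2 * m))) (hp : p ∈ PP m) (T : Fin (2 * m) → Fin (m + 1))
    (hT : IsKrewerasIndex m p T) :
    (2 * π) ^ (m - 1) * ∫ x in Set.univ.pi (fun _ : Fin (m + 1) => Set.Icc (-π) π),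
                Lsig m p T (fun s t => f (s, t)) x =
      ∑ k ∈ Fintype.piFinset (fun _ : Fin (2 * m) => Finset.Icc (-(n:ℤ)) n),
        if memS m p k then TT (QQ P X) p k else 0 := by
  obtain ⟨hp1, hp2⟩ := (Finset.mem_filter.1 hp).2
  have hexp : ∀ x : Fin (m + 1) → ℝ, ((Lsig m p T (fun s t => f (s, t)) x : ℝ) : ℂ) =
      ∑ k ∈ Fintype.piFinset (fun _ : Fin (2 * m) => Finset.Icc (-(n:ℤ)) n),
        (((2 * π : ℂ) ^ 2)⁻¹ ^ m * ((TT (QQ P X) p k : ℝ) : ℂ)) *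
          Complex.exp (Complex.I * ((-∑ j, k j * x (T j) : ℝ) : ℂ)) := by
    intro x
    unfold Lsig
    rw [Complex.ofReal_prod]
    simp_rw [g_exp2 hf hXf]
    rw [prod_sum_pairs p hp]
    refine Finset.sum_congr rfl fun k _ => ?_
    rw [Finset.prod_mul_distrib, Finset.prod_mul_distrib, Finset.prod_const, card_firsts p hp]
    congr 1
    · unfold TT; push_cast; rfl
    · rw [← Complex.exp_sum, ← Finset.mul_sum, ← Complex.ofReal_sum]
      congr 3
      rw [Finset.sum_neg_distrib]
      congr 1
      rw [Finset.sum_add_distrib,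
        ← Finset.sum_filter_add_sum_filter_not Finset.univ (fun i => i < p i) (fun j => (k j : ℝ) * x (T j))]
      congr 1
      refine Finset.sum_bij (fun i _ => p i) ?_ (fun i _ j _ h => p.injective h) ?_ (fun _ _ => rfl)
      · intro i hi
        have := (Finset.mem_filter.1 hi).2
        simp [hp1, this.le]
      · intro i hi
        have := (Finset.mem_filter.1 hi).2
        refine ⟨p i, ?_, hp1 i⟩
        simp only [Finset.mem_filter, Finset.mem_univ, true_and, hp1]
        exact lt_of_le_of_ne (not_lt.1 this) (hp2 i)
  have hfin : volume (Set.univ.pi (fun _ : Fin (m + 1) => Set.Icc (-π) π)) < ⊤ :=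
    (isCompact_univ_pi fun _ => isCompact_Icc).measure_lt_top
  have hC : (((2 * π) ^ (m - 1) * ∫ x in Set.univ.pi (fun _ : Fin (m + 1) => Set.Icc (-π) π),
                Lsig m p T (fun s t => f (s, t)) x : ℝ) : ℂ) =
      ((∑ k ∈ Fintype.piFinset (fun _ : Fin (2 * m) => Finset.Icc (-(n:ℤ)) n),
        if memS m p k then TT (QQ P X) p k else 0 : ℝ) : ℂ) := by
    rw [Complex.ofReal_mul, ← integral_complex_ofReal]
    simp_rw [hexp]
    rw [integral_finsetSum]
    · simp_rw [integral_const_mul, cube_exp', memS_iff p T hT]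
      rw [Finset.mul_sum, Complex.ofReal_sum]
      refine Finset.sum_congr rfl fun k _ => ?_
      split_ifs
      · obtain ⟨r, rfl⟩ : ∃ r, m = r + 1 := ⟨m - 1, by omega⟩
        have hpi : (π : ℂ) ≠ 0 := by exact_mod_cast Real.pi_ne_zero
        have h2 : (2 * π : ℂ) ≠ 0 := mul_ne_zero two_ne_zero hpi
        have key : ∀ c t : ℂ, c ≠ 0 → c ^ r * ((c ^ 2)⁻¹ ^ (r + 1) * t * c ^ (r + 1 + 1)) = t := by
          intro c t hc
          rw [inv_pow, ← pow_mul]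
          field_simp
          ring
        have := key (2 * π : ℂ) ((TT (QQ P X) p k : ℝ) : ℂ) h2
        simpa using this
      · simp
    · intro k _
      have : IsFiniteMeasure (volume.restrict (Set.univ.pi (fun _ : Fin (m + 1) => Set.Icc (-π) π))) :=
        ⟨by simpa using hfin⟩
      refine Integrable.const_mul ?_ _
      refine Integrable.of_bound (C := 1) (Continuous.aestronglyMeasurable (by fun_prop)) (Eventually.of_forall fun q => ?_)
      rw [mul_comm Complex.I, Complex.norm_exp_ofReal_mul_I]
  exact_mod_cast hC
end

open Classical in
/-- **Lemma 3.3.** For a nonnegative trigonometric polynomial `f`, the even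
moments of `μ_f` are given by the pair-partition formulae. -/
theorem statement13 {Ω : Type} [MeasurableSpace Ω] (P : Measure Ω)
    [IsProbabilityMeasure P] (X : ℤ → ℤ → Ω → ℝ) (f : ℝ × ℝ → ℝ)
    (n : ℕ) (hn : 1 ≤ n) (a : ℤ → ℤ → ℝ)
    (hf_nonneg : ∀ q, 0 ≤ f q)
    (hf : ∀ q : ℝ × ℝ, ((f q : ℝ) : ℂ) =
      ∑ j ∈ Finset.Icc (-(n : ℤ)) n, ∑ k ∈ Finset.Icc (-(n : ℤ)) n,
        ((a j k : ℝ) : ℂ) * Complex.exp (Complex.I * ((j * q.1 + k * q.2 : ℝ) : ℂ)))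
    (hX : StatGauss P X) (hXf : HasSpecDensity P X f)
    (μf : Measure ℝ) (hμf : IsProbabilityMeasure μf)
    (hconv : ESDTendstoInProb P (scaledW X) μf) :
    ∀ m : ℕ, 1 ≤ m →
      (((∫ x, x ^ (2 * m) ∂μf : ℝ) : ℂ) =
        ∑ p ∈ NCPairings m, ∑' k : Fin (2 * m) → ℤ,
          if memS m p k then
            ∏ i ∈ Finset.univ.filter (fun i => i < p i),
              (∫ q in specBox,
                Complex.exp (Complex.I * ((k i * q.1 + k (p i) * q.2 : ℝ) : ℂ)) *
                  ((f (q.1, -q.2) + f (-q.2, q.1) : ℝ) : ℂ))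
          else 0) ∧
      ∀ T : Equiv.Perm (Fin (2 * m)) → Fin (2 * m) → Fin (m + 1),
        (∀ p ∈ NCPairings m, IsKrewerasIndex m p (T p)) →
        ∫ x, x ^ (2 * m) ∂μf
          = (2 * π) ^ (m - 1) *
            ∑ p ∈ NCPairings m,
              ∫ x in Set.univ.pi (fun _ : Fin (m + 1) => Set.Icc (-π) π),
                Lsig m p (T p) (fun s t => f (s, t)) x := by
  intro m hm
  have hQ := fun u v => QQ_zero hf hXf u v
  obtain ⟨B, hB⟩ := Q_bdd (QQ P X) n hQ
  have hlim : ∀ m, 1 ≤ m → Tendsto (fun N => ∫ ω, esdEval (scaledW X N ω) (fun x => x ^ (2 * m)) ∂P)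
      atTop (nhds (MM (QQ P X) n m)) := by
    intro m hm
    simp_rw [fun N => mean_W hX N m hm]
    exact mean_lim hm (QQ P X) n B hQ hB
  have hmom := moment_eq (scaledW X) μf hconv (MM (QQ P X) n) (fun m hm N => int_W hX N m hm) hlim m hm
  have hPP : ∀ p ∈ NCPairings m, p ∈ PP m := by
    intro p hp
    have := (Finset.mem_filter.1 hp).2
    simp only [PP, Finset.mem_filter, Finset.mem_univ, true_and]
    exact ⟨this.1, this.2.1⟩
  constructor
  · rw [hmom, MM, Complex.ofReal_sum]
    refine Finset.sum_congr rfl fun p hp => ?_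
    have hterm : ∀ k : Fin (2 * m) → ℤ, (∏ i ∈ Finset.univ.filter (fun i => i < p i),
              (∫ q in specBox,
                Complex.exp (Complex.I * ((k i * q.1 + k (p i) * q.2 : ℝ) : ℂ)) *
                  ((f (q.1, -q.2) + f (-q.2, q.1) : ℝ) : ℂ))) = ((TT (QQ P X) p k : ℝ) : ℂ) := by
      intro k
      simp_rw [ghat hf hXf]
      rw [TT, Complex.ofReal_prod]
    simp_rw [hterm]
    rw [tsum_eq_sum (s := Fintype.piFinset (fun _ : Fin (2 * m) => Finset.Icc (-(n:ℤ)) n)), Complex.ofReal_sum]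
    · refine Finset.sum_congr rfl fun k _ => ?_
      split_ifs <;> simp
    · intro k hk
      rw [TT_zero (QQ P X) n hQ p (hPP p hp) k hk]
      simp
  · intro T hT
    rw [hmom, MM, Finset.mul_sum]
    refine Finset.sum_congr rfl fun p hp => ?_
    rw [int_L hf hXf hm p (hPP p hp) (T p) (hT p hp)]


end
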